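/- arXiv:2605.09991 — 8 statements merged into one kernel-verified Lean document; each statement's English description precedes it below -/
import Mathlib

section
/- There exists a constant M > 0, depending only on (X, y), such that for every λ > 0 and every width m with m ≥ 4P + 4λ²MP, any two points A, B ∈ O_{‖·‖_max}(λ) are joined by a continuous path γ : [0,1] → O_{‖·‖_max}(λ) with γ(0) = A and γ(1) = B. In particular, for each width m ≥ 4P + 1, setting λ_c*(m) = ((m/(4P) − 1)/M)^{1/2}, the set O_{‖·‖_max}(λ) is path-connected whenever 0 < λ ≤ λ_c*(m). -/
open scoped BigOperators

noncomputable def relu (x : ℝ) : ℝ := max x 0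

/-- Output of a two-layer ReLU network: `(XW)₊ α`. -/
noncomputable def nnOut {N D M : Type*} [Fintype N] [Fintype D] [Fintype M]
    (X : Matrix N D ℝ) (W : Matrix D M ℝ) (a : M → ℝ) : N → ℝ :=
  ((X * W).map relu).mulVec a

/-- Entrywise max norm of a matrix. -/
noncomputable def maxNorm {D M : Type*} [Fintype D] [Fintype M] (W : Matrix D M ℝ) : ℝ :=
  ⨆ i, ⨆ j, |W i j|

/-- Frobenius norm of a matrix. -/
noncomputable def frobNorm {D M : Type*} [Fintype D] [Fintype M] (W : Matrix D M ℝ) : ℝ :=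
  Real.sqrt (∑ i, ∑ j, (W i j) ^ 2)

/-- Euclidean (ℓ2) norm of a vector. -/
noncomputable def l2norm {M : Type*} [Fintype M] (v : M → ℝ) : ℝ :=
  Real.sqrt (∑ i, (v i) ^ 2)

/-- ℓ∞ norm of a vector. -/
noncomputable def linfNorm {M : Type*} [Fintype M] (v : M → ℝ) : ℝ :=
  ⨆ i, |v i|

/-- Operator norm (largest singular value) of a matrix, as the supremum of
`‖W v‖₂` over the Euclidean unit ball. -/
noncomputable def opNorm {D M : Type*} [Fintype D] [Fintype M] (W : Matrix D M ℝ) : ℝ :=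
  ⨆ v : {v : M → ℝ // l2norm v ≤ 1}, l2norm (W.mulVec v.1)

/-- The `i`-th column of a matrix. -/
def mcol {D M R : Type*} (W : Matrix D M R) (i : M) : D → R := fun r => W r i

/-- Regularized solution set `O_R(λ)`. -/
def solSet {N D M : Type*} [Fintype N] [Fintype D] [Fintype M]
    (X : Matrix N D ℝ) (y : N → ℝ)
    (R : Matrix D M ℝ → ℝ) (Rv : (M → ℝ) → ℝ) (lam : ℝ) :
    Set (Matrix D M ℝ × (M → ℝ)) :=
  {p | nnOut X p.1 p.2 = y ∧ R p.1 ≤ 1 / lam ∧ Rv p.2 ≤ 1 / lam}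

/-- Hyperplane arrangement pattern `1(Xh ≥ 0)` of a vector `h`. -/
noncomputable def pattern {N D : Type*} [Fintype N] [Fintype D]
    (X : Matrix N D ℝ) (h : D → ℝ) : N → Bool :=
  fun i => decide (0 ≤ X.mulVec h i)

open Filter Topology

lemma key_bound {G E F J : Type*} [Fintype G] [Finite J] [NormedAddCommGroup E] [NormedSpace ℝ E]
    [FiniteDimensional ℝ E] [NormedAddCommGroup F] [NormedSpace ℝ F]
    (f : J → (G → E) →ₗ[ℝ] ℝ) (T : (G → E) →ₗ[ℝ] F) (y : F) :
    ∃ M : ℝ, 0 < M ∧ ∀ v : G → E, (∀ j, 0 ≤ f j v) → T v = y →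
      ∃ v0 : G → E, (∀ j, 0 ≤ f j v0) ∧ T v0 = y ∧ ∀ g, ‖v0 g‖ ≤ ‖v g‖ ∧ ‖v0 g‖ ≤ M := by
  classical
  have hfc : ∀ j, Continuous (f j) := fun j => LinearMap.continuous_of_finiteDimensional _
  have hTc : Continuous T := LinearMap.continuous_of_finiteDimensional _
  haveI : ProperSpace (G → E) := FiniteDimensional.proper ℝ _
  let Min : (G → E) → Prop := fun v => (∀ j, 0 ≤ f j v) ∧ T v = y ∧
    ∀ v' : G → E, (∀ j, 0 ≤ f j v') → T v' = y → (∀ g, ‖v' g‖ ≤ ‖v g‖) →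
      ∑ g, ‖v g‖ ≤ ∑ g, ‖v' g‖
  -- minimizers exist
  have hex : ∀ v : G → E, (∀ j, 0 ≤ f j v) → T v = y →
      ∃ v0, Min v0 ∧ ∀ g, ‖v0 g‖ ≤ ‖v g‖ := by
    intro v hv hT
    let S : Set (G → E) := {w | (∀ j, 0 ≤ f j w) ∧ T w = y ∧ ∀ g, ‖w g‖ ≤ ‖v g‖}
    have hScl : IsClosed S := by
      have h1 : IsClosed {w : G → E | ∀ j, 0 ≤ f j w} := by
        simp only [Set.setOf_forall]
        exact isClosed_iInter fun j => isClosed_le continuous_const (hfc j)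
      have h2 : IsClosed {w : G → E | T w = y} := isClosed_eq hTc continuous_const
      have h3 : IsClosed {w : G → E | ∀ g, ‖w g‖ ≤ ‖v g‖} := by
        simp only [Set.setOf_forall]
        exact isClosed_iInter fun g => isClosed_le (continuous_apply g).norm continuous_const
      exact h1.inter (h2.inter h3)
    have hSb : Bornology.IsBounded S := by
      refine (Metric.isBounded_closedBall (x := (0 : G → E)) (r := ‖v‖)).subset ?_
      intro w hw
      rw [mem_closedBall_zero_iff, pi_norm_le_iff_of_nonneg (norm_nonneg _)]
      intro g
      exact (hw.2.2 g).trans (norm_le_pi_norm v g)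
    have hSc : IsCompact S := Metric.isCompact_of_isClosed_isBounded hScl hSb
    obtain ⟨w, hwS, hw⟩ := hSc.exists_isMinOn ⟨v, hv, hT, fun g => le_rfl⟩
      (f := fun w : G → E => ∑ g, ‖w g‖)
      (continuous_finset_sum _ fun g _ => (continuous_apply g).norm).continuousOn
    refine ⟨w, ⟨hwS.1, hwS.2.1, ?_⟩, hwS.2.2⟩
    intro v' h1 h2 h3
    exact hw ⟨h1, h2, fun g => (h3 g).trans (hwS.2.2 g)⟩
  -- minimizers are bounded
  have hbd : ∃ M : ℝ, ∀ v, Min v → ‖v‖ ≤ M := by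
    by_contra hcon
    push Not at hcon
    choose v hvm hvn using fun k : ℕ => hcon ((k : ℝ) + 1)
    have hpos : ∀ k, 0 < ‖v k‖ := fun k => lt_trans (by positivity) (hvn k)
    let x : ℕ → (G → E) := fun k => (‖v k‖)⁻¹ • v k
    have hx1 : ∀ k, x k ∈ Metric.sphere (0 : G → E) 1 := by
      intro k
      rw [mem_sphere_zero_iff_norm]
      simp only [x]
      rw [norm_smul, norm_inv, norm_norm, inv_mul_cancel₀ (hpos k).ne']
    obtain ⟨z, hz, φ, hφ, hlim⟩ := (isCompact_sphere (0 : G → E) 1).tendsto_subseq hx1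
    have hfz : ∀ j, 0 ≤ f j z := by
      intro j
      refine ge_of_tendsto' (((hfc j).tendsto z).comp hlim) ?_
      intro k
      simp only [Function.comp, x, map_smul, smul_eq_mul]
      exact mul_nonneg (inv_nonneg.2 (norm_nonneg _)) ((hvm _).1 j)
    have hTz : T z = 0 := by
      have h1 : Tendsto (fun k => T (x (φ k))) atTop (𝓝 (T z)) := (hTc.tendsto z).comp hlim
      have h2 : Tendsto (fun k => T (x (φ k))) atTop (𝓝 0) := by
        have h3 : Tendsto (fun k => ‖v (φ k)‖) atTop atTop := by
          refine tendsto_atTop_mono (f := fun k : ℕ => (k : ℝ)) ?_ tendsto_natCast_atTop_atTop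
          intro k
          have := hvn (φ k)
          have h4 : (k : ℝ) ≤ φ k := by exact_mod_cast hφ.id_le k
          linarith
        have h5 := (tendsto_inv_atTop_zero.comp h3).smul_const y
        rw [zero_smul] at h5
        refine h5.congr ?_
        intro k
        simp only [Function.comp, x, map_smul, (hvm _).2.1]
      exact tendsto_nhds_unique h1 h2
    have hz1 : ‖z‖ = 1 := mem_sphere_zero_iff_norm.1 hz
    -- eventually facts
    have e1 : ∀ᶠ k in atTop, ∀ j, 0 ≤ f j (x (φ k) - (1/2 : ℝ) • z) := by
      rw [eventually_all]
      intro j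
      rcases (hfz j).eq_or_lt with h | h
      · refine Eventually.of_forall fun k => ?_
        rw [map_sub, (f j).map_smul (1/2 : ℝ) z, ← h, smul_zero, sub_zero]
        simp only [x, map_smul, smul_eq_mul]
        exact mul_nonneg (inv_nonneg.2 (norm_nonneg _)) ((hvm _).1 j)
      · have h1 : Tendsto (fun k => f j (x (φ k))) atTop (𝓝 (f j z)) :=
          ((hfc j).tendsto z).comp hlim
        filter_upwards [h1.eventually (lt_mem_nhds (show f j z / 2 < f j z by linarith))] with k hk
        rw [map_sub, (f j).map_smul (1/2 : ℝ) z, smul_eq_mul]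
        linarith
    have e2 : ∀ᶠ k in atTop, ∀ g, ‖(x (φ k) - (1/2 : ℝ) • z) g‖ ≤ ‖x (φ k) g‖ ∧
        (z g ≠ 0 → ‖(x (φ k) - (1/2 : ℝ) • z) g‖ < ‖x (φ k) g‖) := by
      rw [eventually_all]
      intro g
      by_cases h : z g = 0
      · refine Eventually.of_forall fun k => ?_
        simp [h]
      · have h0 : Tendsto (fun k => x (φ k) g) atTop (𝓝 (z g)) :=
          ((continuous_apply g).tendsto z).comp hlim
        have h1 := h0.norm
        have h2 : Tendsto (fun k => ‖(x (φ k) - (1/2 : ℝ) • z) g‖) atTop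
            (𝓝 ‖z g - (1/2 : ℝ) • z g‖) := (h0.sub_const ((1/2 : ℝ) • z g)).norm
        have h3 : ‖z g - (1/2 : ℝ) • z g‖ < ‖z g‖ := by
          have : z g - (1/2 : ℝ) • z g = (1/2 : ℝ) • z g := by
            rw [sub_eq_iff_eq_add, ← add_smul]; norm_num
          rw [this, norm_smul]
          have := norm_pos_iff.2 h
          norm_num
          linarith
        filter_upwards [h2.eventually_lt h1 h3] with k hk
        exact ⟨hk.le, fun _ => hk⟩
    obtain ⟨k, hk1, hk2⟩ := (e1.and e2).exists
    set N := ‖v (φ k)‖ with hN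
    have hNp : 0 < N := hpos _
    have hxv : N • x (φ k) = v (φ k) := by
      simp only [x]
      rw [smul_smul, mul_inv_cancel₀ hNp.ne', one_smul]
    have hmin := (hvm (φ k)).2.2 (N • (x (φ k) - (1/2 : ℝ) • z)) ?_ ?_ ?_
    · obtain ⟨g0, hg0⟩ : ∃ g, z g ≠ 0 := by
        by_contra h
        push Not at h
        have : z = 0 := funext h
        rw [this, norm_zero] at hz1
        exact zero_ne_one hz1
      have : ∑ g, ‖(N • (x (φ k) - (1/2 : ℝ) • z)) g‖ < ∑ g, ‖v (φ k) g‖ := by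
        refine Finset.sum_lt_sum ?_ ⟨g0, Finset.mem_univ _, ?_⟩
        · intro g _
          rw [← hxv, Pi.smul_apply, Pi.smul_apply, norm_smul, norm_smul]
          exact mul_le_mul_of_nonneg_left (hk2 g).1 (norm_nonneg _)
        · rw [← hxv, Pi.smul_apply, Pi.smul_apply, norm_smul, norm_smul]
          exact mul_lt_mul_of_pos_left ((hk2 g0).2 hg0) (norm_pos_iff.2 hNp.ne')
      linarith
    · intro j
      rw [map_smul, smul_eq_mul]
      exact mul_nonneg hNp.le (hk1 j)
    · rw [smul_sub, map_sub, hxv, map_smul, map_smul, hTz, smul_zero, smul_zero, sub_zero]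
      exact (hvm _).2.1
    · intro g
      rw [← hxv, Pi.smul_apply, Pi.smul_apply, norm_smul, norm_smul]
      exact mul_le_mul_of_nonneg_left (hk2 g).1 (norm_nonneg _)
  obtain ⟨M, hM⟩ := hbd
  refine ⟨max M 1, by positivity, ?_⟩
  intro v hv hT
  obtain ⟨v0, hm, hle⟩ := hex v hv hT
  exact ⟨v0, hm.1, hm.2.1, fun g => ⟨hle g,
    (norm_le_pi_norm v0 g).trans ((hM v0 hm).trans (le_max_left _ _))⟩⟩

/-- Concrete description of the solution set. -/
def SS {n d : ℕ} (X : Matrix (Fin n) (Fin d) ℝ) (y : Fin n → ℝ) (r : ℝ) (m : ℕ) :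
    Set (Matrix (Fin d) (Fin m) ℝ × (Fin m → ℝ)) :=
  {p | (∀ j, ∑ i, relu (X.mulVec (mcol p.1 i) j) * p.2 i = y j) ∧
    (∀ k i, |p.1 k i| ≤ r) ∧ ∀ i, |p.2 i| ≤ r}

lemma solSet_eq_SS {n d : ℕ} (X : Matrix (Fin n) (Fin d) ℝ) (y : Fin n → ℝ) (lam : ℝ)
    (hl : 0 < lam) (m : ℕ) :
    solSet (M := Fin m) X y maxNorm linfNorm lam = SS X y (1 / lam) m := by
  have hr : 0 ≤ 1 / lam := by positivity
  ext ⟨W, a⟩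
  simp only [solSet, SS, Set.mem_setOf_eq]
  refine and_congr ?_ (and_congr ?_ ?_)
  · rw [funext_iff]
    rfl
  · unfold maxNorm
    constructor
    · intro h k i
      refine le_trans ?_ h
      refine le_trans ?_ (le_ciSup (f := fun k => ⨆ j, |W k j|) (Set.finite_range _).bddAbove k)
      exact le_ciSup (f := fun j => |W k j|) (Set.finite_range _).bddAbove i
    · intro h
      exact Real.iSup_le (fun k => Real.iSup_le (fun i => h k i) hr) hr
  · unfold linfNorm
    constructor
    · intro h i
      exact le_trans (le_ciSup (f := fun j => |a j|) (Set.finite_range _).bddAbove i) h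
    · intro h
      exact Real.iSup_le (fun i => h i) hr

lemma abs_comb {a b r t : ℝ} (ha : |a| ≤ r) (hb : |b| ≤ r) (h0 : 0 ≤ t) (h1 : t ≤ 1) :
    |(1 - t) * a + t * b| ≤ r := by
  rw [abs_le] at *
  constructor <;> nlinarith

lemma relu_comb {a b t : ℝ} (h : (0 ≤ a ∧ 0 ≤ b) ∨ (a ≤ 0 ∧ b ≤ 0)) (h0 : 0 ≤ t) (h1 : t ≤ 1) :
    relu ((1 - t) * a + t * b) = (1 - t) * relu a + t * relu b := by
  unfold relu
  rcases h with ⟨ha, hb⟩ | ⟨ha, hb⟩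
  · rw [max_eq_left ha, max_eq_left hb, max_eq_left]
    have := mul_nonneg (sub_nonneg.2 h1) ha
    have := mul_nonneg h0 hb
    linarith
  · rw [max_eq_right ha, max_eq_right hb, max_eq_right]
    · ring
    · have := mul_nonneg (sub_nonneg.2 h1) (neg_nonneg.2 ha)
      have := mul_nonneg h0 (neg_nonneg.2 hb)
      linarith

lemma relu_mul {c a : ℝ} (hc : 0 ≤ c) : relu (c * a) = c * relu a := by
  unfold relu
  rw [mul_max_of_nonneg _ _ hc, mul_zero]

section paths
variable {n d m : ℕ} {X : Matrix (Fin n) (Fin d) ℝ} {y : Fin n → ℝ} {r : ℝ}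

lemma join_alpha {W : Matrix (Fin d) (Fin m) ℝ} {a b : Fin m → ℝ}
    (ha : (W, a) ∈ SS X y r m) (hb : (W, b) ∈ SS X y r m) :
    JoinedIn (SS X y r m) (W, a) (W, b) := by
  refine JoinedIn.ofLine (f := fun t : ℝ => (W, fun i => (1 - t) * a i + t * b i)) ?_ ?_ ?_ ?_
  · exact Continuous.continuousOn (by fun_prop)
  · simp
  · simp
  · rintro _ ⟨t, ⟨h0, h1⟩, rfl⟩
    refine ⟨?_, ha.2.1, fun i => abs_comb (ha.2.2 i) (hb.2.2 i) h0 h1⟩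
    intro j
    have h2 := ha.1 j
    have h3 := hb.1 j
    simp only at h2 h3 ⊢
    calc _ = (1 - t) * ∑ i, relu (X.mulVec (mcol W i) j) * a i
          + t * ∑ i, relu (X.mulVec (mcol W i) j) * b i := by
          rw [Finset.mul_sum, Finset.mul_sum, ← Finset.sum_add_distrib]
          exact Finset.sum_congr rfl fun i _ => by ring
      _ = y j := by rw [h2, h3]; ring

lemma join_W {W V : Matrix (Fin d) (Fin m) ℝ} {a : Fin m → ℝ}
    (hW : (W, a) ∈ SS X y r m) (hV : (V, a) ∈ SS X y r m)
    (hc : ∀ i j, (0 ≤ X.mulVec (mcol W i) j ∧ 0 ≤ X.mulVec (mcol V i) j) ∨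
      (X.mulVec (mcol W i) j ≤ 0 ∧ X.mulVec (mcol V i) j ≤ 0)) :
    JoinedIn (SS X y r m) (W, a) (V, a) := by
  refine JoinedIn.ofLine (f := fun t : ℝ => ((1 - t) • W + t • V, a)) ?_ ?_ ?_ ?_
  · exact Continuous.continuousOn (by fun_prop)
  · simp
  · simp
  · rintro _ ⟨t, ⟨h0, h1⟩, rfl⟩
    refine ⟨?_, fun k i => abs_comb (hW.2.1 k i) (hV.2.1 k i) h0 h1, hW.2.2⟩
    intro j
    have h2 := hW.1 j
    have h3 := hV.1 j
    simp only at h2 h3 ⊢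
    calc _ = (1 - t) * ∑ i, relu (X.mulVec (mcol W i) j) * a i
          + t * ∑ i, relu (X.mulVec (mcol V i) j) * a i := by
          rw [Finset.mul_sum, Finset.mul_sum, ← Finset.sum_add_distrib]
          refine Finset.sum_congr rfl fun i _ => ?_
          have : mcol ((1 - t) • W + t • V) i = (1 - t) • mcol W i + t • mcol V i := rfl
          rw [this, Matrix.mulVec_add, Matrix.mulVec_smul, Matrix.mulVec_smul, Pi.add_apply,
            Pi.smul_apply, Pi.smul_apply, smul_eq_mul, smul_eq_mul, relu_comb (hc i j) h0 h1]
          ring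
      _ = y j := by rw [h2, h3]; ring

lemma relu_zero' : relu 0 = 0 := by simp [relu]

lemma join_compat {W V : Matrix (Fin d) (Fin m) ℝ} {a b : Fin m → ℝ}
    (hW : (W, a) ∈ SS X y r m) (hV : (V, b) ∈ SS X y r m)
    (hc : ∀ i, mcol W i = 0 ∨ mcol V i = 0 ∨ (mcol W i = mcol V i ∧ a i = b i)) :
    JoinedIn (SS X y r m) (W, a) (V, b) := by
  classical
  let c : Fin m → ℝ := fun i => if mcol W i = 0 then b i else a i
  have hcr : ∀ i, |c i| ≤ r := by
    intro i
    simp only [c]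
    split_ifs
    · exact hV.2.2 i
    · exact hW.2.2 i
  have hWc : (W, c) ∈ SS X y r m := by
    refine ⟨fun j => ?_, hW.2.1, hcr⟩
    rw [← hW.1 j]
    refine Finset.sum_congr rfl fun i _ => ?_
    by_cases h : mcol W i = 0
    · simp [h, relu_zero']
    · simp [c, h]
  have hVc : (V, c) ∈ SS X y r m := by
    refine ⟨fun j => ?_, hV.2.1, hcr⟩
    rw [← hV.1 j]
    refine Finset.sum_congr rfl fun i _ => ?_
    by_cases h : mcol W i = 0
    · simp [c, h]
    · rcases hc i with h' | h' | h'
      · exact absurd h' h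
      · simp [h', relu_zero']
      · simp [c, h, h'.2]
  refine (join_alpha hW hWc).trans ((join_W hWc hVc ?_).trans (join_alpha hVc hV))
  intro i j
  rcases hc i with h' | h' | h'
  · rw [h', Matrix.mulVec_zero, Pi.zero_apply]
    rcases le_total 0 (X.mulVec (mcol V i) j) with h | h
    · exact Or.inl ⟨le_rfl, h⟩
    · exact Or.inr ⟨le_rfl, h⟩
  · rw [h', Matrix.mulVec_zero, Pi.zero_apply]
    rcases le_total 0 (X.mulVec (mcol W i) j) with h | h
    · exact Or.inl ⟨h, le_rfl⟩
    · exact Or.inr ⟨h, le_rfl⟩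
  · rw [h'.1]
    rcases le_total 0 (X.mulVec (mcol V i) j) with h | h
    · exact Or.inl ⟨h, h⟩
    · exact Or.inr ⟨h, h⟩

open Classical in
/-- active neurons -/
noncomputable def supp (W : Matrix (Fin d) (Fin m) ℝ) : Finset (Fin m) :=
  Finset.univ.filter fun i => mcol W i ≠ 0

lemma mem_supp {W : Matrix (Fin d) (Fin m) ℝ} {i : Fin m} : i ∈ supp W ↔ mcol W i ≠ 0 := by
  simp [supp]

lemma join_small {V : Matrix (Fin d) (Fin m) ℝ} {b : Fin m → ℝ}
    (hV : (V, b) ∈ SS X y r m) : ∀ (k : ℕ) (W : Matrix (Fin d) (Fin m) ℝ) (a : Fin m → ℝ),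
    (W, a) ∈ SS X y r m → (supp W).card + (supp V).card ≤ m →
    (supp W ∩ supp V).card = k → JoinedIn (SS X y r m) (W, a) (V, b) := by
  classical
  intro k
  induction k with
  | zero =>
    intro W a hW _ hk
    refine join_compat hW hV fun i => ?_
    rw [Finset.card_eq_zero] at hk
    by_contra hcon
    push Not at hcon
    have : i ∈ supp W ∩ supp V :=
      Finset.mem_inter.2 ⟨mem_supp.2 hcon.1, mem_supp.2 hcon.2.1⟩
    rw [hk] at this
    simp at this
  | succ k ih =>
    intro W a hW hm hk
    obtain ⟨i, hi⟩ : (supp W ∩ supp V).Nonempty := by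
      rw [← Finset.card_pos]; omega
    obtain ⟨hiW, hiV⟩ := Finset.mem_inter.1 hi
    obtain ⟨j, hj⟩ : ∃ j, j ∉ supp W ∪ supp V := by
      by_contra hcon
      push Not at hcon
      have h1 : supp W ∪ supp V = Finset.univ := Finset.eq_univ_iff_forall.2 hcon
      have h2 := Finset.card_union_add_card_inter (supp W) (supp V)
      rw [h1, Finset.card_univ, Fintype.card_fin] at h2
      omega
    rw [Finset.mem_union, not_or] at hj
    obtain ⟨hjW, hjV⟩ := hj
    have hij : i ≠ j := fun h => hjW (h ▸ hiW)
    let σ : Equiv.Perm (Fin m) := Equiv.swap i j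
    let W' : Matrix (Fin d) (Fin m) ℝ := fun k l => W k (σ l)
    let a' : Fin m → ℝ := fun l => a (σ l)
    have hcol : ∀ l, mcol W' l = mcol W (σ l) := fun l => rfl
    have hW' : (W', a') ∈ SS X y r m := by
      refine ⟨fun q => ?_, fun k l => hW.2.1 k (σ l), fun l => hW.2.2 (σ l)⟩
      rw [← hW.1 q]
      exact Equiv.sum_comp σ (fun l => relu (X.mulVec (mcol W l) q) * a l)
    have hjz : mcol W j = 0 := by
      by_contra h; exact hjW (mem_supp.2 h)
    have hmem : ∀ l, l ∈ supp W' ↔ σ l ∈ supp W := fun l => by rw [mem_supp, mem_supp, hcol]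
    have hcard : (supp W').card = (supp W).card := by
      refine Finset.card_bij (fun l _ => σ l) ?_ ?_ ?_
      · intro l hl; exact (hmem l).1 hl
      · intro l _ l' _ h; exact σ.injective h
      · intro l hl
        exact ⟨σ.symm l, (hmem _).2 (by simpa using hl), by simp⟩
    have hint : supp W' ∩ supp V = (supp W ∩ supp V).erase i := by
      ext l
      simp only [Finset.mem_inter, Finset.mem_erase, hmem]
      by_cases h1 : l = i
      · subst h1
        simp [σ, hjW]
      · by_cases h2 : l = j
        · subst h2
          simp [hjV]
        · simp [σ, Equiv.swap_apply_of_ne_of_ne h1 h2, h1]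
    refine (join_compat hW hW' ?_).trans (ih W' a' hW' (by omega) ?_)
    · intro l
      by_cases h1 : l = i
      · subst h1
        right; left
        rw [hcol]
        simp [σ, hjz]
      · by_cases h2 : l = j
        · subst h2
          left; exact hjz
        · right; right
          simp [hcol, a', σ, Equiv.swap_apply_of_ne_of_ne h1 h2]
    · rw [hint, Finset.card_erase_of_mem hi, hk]; rfl

lemma join_norm (hr : 0 < r) {W : Matrix (Fin d) (Fin m) ℝ} {a : Fin m → ℝ}
    (hW : (W, a) ∈ SS X y r m) :
    ∃ (V : Matrix (Fin d) (Fin m) ℝ) (s : Fin m → Bool),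
      (V, fun i => if s i then r else -r) ∈ SS X y r m ∧
      JoinedIn (SS X y r m) (W, a) (V, fun i => if s i then r else -r) := by
  classical
  -- first kill neurons with zero outer weight
  let W1 : Matrix (Fin d) (Fin m) ℝ := fun k i => if a i = 0 then 0 else W k i
  have hcol0 : ∀ i, a i = 0 → mcol W1 i = 0 := fun i h => by
    funext k; simp [mcol, W1, h]
  have hcol1 : ∀ i, a i ≠ 0 → mcol W1 i = mcol W i := fun i h => by
    funext k; simp [mcol, W1, h]
  have hW1 : (W1, a) ∈ SS X y r m := by
    refine ⟨fun j => ?_, fun k i => ?_, hW.2.2⟩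
    · rw [← hW.1 j]
      refine Finset.sum_congr rfl fun i _ => ?_
      by_cases h : a i = 0
      · simp [h]
      · simp only [hcol1 i h]
    · simp only [W1]
      split_ifs
      · simpa using hr.le
      · exact hW.2.1 k i
  have j1 : JoinedIn (SS X y r m) (W, a) (W1, a) := by
    refine join_compat hW hW1 fun i => ?_
    by_cases h : a i = 0
    · exact Or.inr (Or.inl (hcol0 i h))
    · exact Or.inr (Or.inr ⟨(hcol1 i h).symm, rfl⟩)
  let s : Fin m → Bool := fun i => decide (0 ≤ a i)
  let e : Fin m → ℝ := fun i => if s i then r else -r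
  let at' : ℝ → Fin m → ℝ := fun t i => (1 - t) * a i + t * e i
  let c : ℝ → Fin m → ℝ := fun t i => if a i = 0 then 0 else a i / at' t i
  have he : ∀ i, |e i| ≤ r := by
    intro i
    simp only [e]
    split_ifs
    · rw [abs_of_pos hr]
    · rw [abs_neg, abs_of_pos hr]
  have hsg : ∀ i, a i ≠ 0 → ∀ t ∈ Set.Icc (0:ℝ) 1,
      at' t i ≠ 0 ∧ 0 ≤ a i / at' t i ∧ a i / at' t i ≤ 1 := by
    intro i hi t ht
    obtain ⟨h0, h1⟩ := ht
    have hb := abs_le.1 (hW.2.2 i)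
    simp only at hb
    rcases lt_or_gt_of_ne hi with h | h
    · have hs : e i = -r := by simp [e, s, h]
      have h2 : at' t i ≤ a i := by
        simp only [at', hs]; nlinarith
      have h3 : at' t i < 0 := by linarith
      exact ⟨h3.ne, div_nonneg_of_nonpos h.le h3.le, (div_le_one_of_neg h3).2 h2⟩
    · have hs : e i = r := by simp [e, s, h.le]
      have h2 : a i ≤ at' t i := by
        simp only [at', hs]; nlinarith
      have h3 : 0 < at' t i := by linarith
      exact ⟨h3.ne', div_nonneg h.le h3.le, (div_le_one h3).2 h2⟩
  let F : ℝ → Matrix (Fin d) (Fin m) ℝ × (Fin m → ℝ) := fun t => (fun k i => c t i * W1 k i, at' t)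
  have hF : ∀ t ∈ Set.Icc (0:ℝ) 1, F t ∈ SS X y r m := by
    intro t ht
    refine ⟨fun j => ?_, fun k i => ?_, fun i => abs_comb (hW.2.2 i) (he i) ht.1 ht.2⟩
    · rw [← hW1.1 j]
      refine Finset.sum_congr rfl fun i _ => ?_
      have hm : mcol (F t).1 i = c t i • mcol W1 i := rfl
      rw [hm, Matrix.mulVec_smul, Pi.smul_apply, smul_eq_mul]
      by_cases h : a i = 0
      · simp [hcol0 i h, relu_zero']
      · obtain ⟨h1, h2, h3⟩ := hsg i h t ht
        have hc : c t i = a i / at' t i := by simp [c, h]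
        rw [hc, relu_mul h2]
        simp only [F]
        field_simp
    · change |c t i * W1 k i| ≤ r
      by_cases h : a i = 0
      · simp [c, h, hr.le]
      · obtain ⟨h1, h2, h3⟩ := hsg i h t ht
        have hc : c t i = a i / at' t i := by simp [c, h]
        rw [abs_mul, hc, abs_of_nonneg h2]
        calc _ ≤ 1 * |W1 k i| := mul_le_mul_of_nonneg_right h3 (abs_nonneg _)
          _ ≤ r := by rw [one_mul]; exact hW1.2.1 k i
  have hF0 : F 0 = (W1, a) := by
    refine Prod.ext ?_ ?_
    · funext k i
      by_cases h : a i = 0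
      · simp [F, c, W1, h]
      · simp [F, c, at', h]
    · funext i; simp [F, at']
  have hF1 : F 1 = ((F 1).1, e) := by
    refine Prod.ext rfl ?_
    funext i; simp [F, at']
  have hFc : ContinuousOn F (Set.Icc 0 1) := by
    refine ContinuousOn.prodMk ?_ ?_
    · refine continuousOn_pi.2 fun k => continuousOn_pi.2 fun i => ?_
      by_cases h : a i = 0
      · simp only [c, h, if_true]
        exact continuousOn_const
      · simp only [c, h, if_false]
        refine ContinuousOn.mul (ContinuousOn.div continuousOn_const ?_ fun t ht => (hsg i h t ht).1)
          continuousOn_const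
        exact Continuous.continuousOn (by simp only [at']; fun_prop)
    · exact Continuous.continuousOn (by simp only [at']; fun_prop)
  refine ⟨(F 1).1, s, ?_, j1.trans ?_⟩
  · have := hF 1 ⟨zero_le_one, le_rfl⟩
    rw [hF1] at this
    exact this
  · refine JoinedIn.ofLine hFc hF0 hF1 ?_
    rintro _ ⟨t, ht, rfl⟩
    exact hF t ht

end paths

lemma relu_pattern {n d : ℕ} (X : Matrix (Fin n) (Fin d) ℝ) (p : Fin n → Bool) (w : Fin d → ℝ)
    (j : Fin n) (h : 0 ≤ (if p j then (1:ℝ) else -1) * X.mulVec w j) :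
    relu (X.mulVec w j) = (if p j then (1:ℝ) else 0) * X.mulVec w j := by
  unfold relu
  split_ifs at h ⊢
  · rw [max_eq_left (by linarith), one_mul]
  · rw [max_eq_right (by linarith), zero_mul]

lemma reduce {n d : ℕ} (X : Matrix (Fin n) (Fin d) ℝ) (y : Fin n → ℝ) :
    ∃ M : ℝ, 0 < M ∧ ∀ (r : ℝ), 0 < r → ∀ (m : ℕ) (W : Matrix (Fin d) (Fin m) ℝ)
      (s : Fin m → Bool), (W, fun i => if s i then r else -r) ∈ SS X y r m →
      ∃ V : Matrix (Fin d) (Fin m) ℝ, (V, fun i => if s i then r else -r) ∈ SS X y r m ∧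
        JoinedIn (SS X y r m) (W, fun i => if s i then r else -r)
          (V, fun i => if s i then r else -r) ∧
        ((supp V).card : ℝ) ≤ 2 * (Set.ncard (Set.range (pattern X)) : ℝ) * (M / r ^ 2 + 1) := by
  classical
  let Pt := Set.range (pattern X)
  haveI : Fintype Pt := Fintype.ofFinite _
  let G := Pt × Bool
  let f : G × Fin n → (G → Fin d → ℝ) →ₗ[ℝ] ℝ := fun gj =>
    (if gj.1.1.1 gj.2 then (1:ℝ) else -1) •
      (LinearMap.proj gj.2 ∘ₗ X.mulVecLin ∘ₗ LinearMap.proj gj.1)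
  let T : (G → Fin d → ℝ) →ₗ[ℝ] (Fin n → ℝ) := LinearMap.pi fun j => ∑ g : G,
    ((if g.2 then (1:ℝ) else -1) * (if g.1.1 j then (1:ℝ) else 0)) •
      (LinearMap.proj j ∘ₗ X.mulVecLin ∘ₗ LinearMap.proj g)
  have hf : ∀ g j v, f (g, j) v = (if g.1.1 j then (1:ℝ) else -1) * X.mulVec (v g) j := by
    intro g j v; rfl
  have hT : ∀ v j, T v j = ∑ g : G,
      ((if g.2 then (1:ℝ) else -1) * (if g.1.1 j then (1:ℝ) else 0)) * X.mulVec (v g) j := by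
    intro v j
    simp only [T, LinearMap.pi_apply, LinearMap.sum_apply]
    rfl
  obtain ⟨M, hM, key⟩ := key_bound f T y
  refine ⟨M, hM, ?_⟩
  intro r hr m W s hW
  let grp : Fin m → G := fun i => (⟨pattern X (mcol W i), Set.mem_range_self _⟩, s i)
  let fib : G → Finset (Fin m) := fun g => Finset.univ.filter fun i => grp i = g
  have hmf : ∀ g i, i ∈ fib g ↔ grp i = g := fun g i => by simp [fib]
  -- cone membership predicate
  let Cn : Matrix (Fin d) (Fin m) ℝ → Prop := fun V => ∀ i j,
    0 ≤ (if (grp i).1.1 j then (1:ℝ) else -1) * X.mulVec (mcol V i) j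
  let U : Matrix (Fin d) (Fin m) ℝ → G → Fin d → ℝ := fun V g => r • ∑ i ∈ fib g, mcol V i
  have hout : ∀ V, Cn V → ∀ j,
      ∑ i, relu (X.mulVec (mcol V i) j) * (if s i then r else -r) = T (U V) j := by
    intro V hV j
    rw [hT, ← Finset.sum_fiberwise (s := Finset.univ) (g := grp)]
    refine Finset.sum_congr rfl fun g _ => ?_
    simp only [U]
    rw [Matrix.mulVec_smul, Matrix.mulVec_sum, Pi.smul_apply, Finset.sum_apply, smul_eq_mul,
      Finset.mul_sum, Finset.mul_sum]
    refine Finset.sum_congr rfl fun i hi => ?_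
    have hg : grp i = g := (hmf g i).1 hi
    rw [relu_pattern X (grp i).1.1 _ j (hV i j)]
    have hs : s i = g.2 := by rw [← hg]
    rw [hs, hg]
    cases g.2 <;> simp <;> split_ifs <;> ring
  have hCW : Cn W := by
    intro i j
    simp only [grp, pattern, decide_eq_true_eq]
    split_ifs with h
    · linarith
    · linarith
  have hTW : T (U W) = y := by
    funext j
    rw [← hout W hCW j]
    exact hW.1 j
  have hfW : ∀ gj, 0 ≤ f gj (U W) := by
    rintro ⟨g, j⟩
    rw [hf]
    simp only [U]
    rw [Matrix.mulVec_smul, Matrix.mulVec_sum, Pi.smul_apply, Finset.sum_apply, smul_eq_mul,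
      mul_left_comm, Finset.mul_sum]
    refine mul_nonneg hr.le (Finset.sum_nonneg fun i hi => ?_)
    have hg : grp i = g := (hmf g i).1 hi
    rw [← hg]
    exact hCW i j
  obtain ⟨v0, hv0, hTv0, hb⟩ := key (U W) hfW hTW
  let k : G → ℕ := fun g => ⌈‖v0 g‖ / r ^ 2⌉₊
  have hk1 : ∀ g, ‖v0 g‖ ≤ k g * r ^ 2 := by
    intro g
    have := Nat.le_ceil (‖v0 g‖ / r ^ 2)
    rwa [div_le_iff₀ (by positivity)] at this
  have hk2 : ∀ g, (k g : ℝ) ≤ M / r ^ 2 + 1 := by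
    intro g
    have h1 := Nat.ceil_lt_add_one (a := ‖v0 g‖ / r ^ 2) (by positivity)
    have h2 : ‖v0 g‖ / r ^ 2 ≤ M / r ^ 2 :=
      div_le_div_of_nonneg_right (hb g).2 (by positivity)
    exact h1.le.trans (by linarith)
  have hk3 : ∀ g, k g ≤ (fib g).card := by
    intro g
    refine Nat.ceil_le.2 ?_
    rw [div_le_iff₀ (by positivity)]
    refine (hb g).1.trans ?_
    simp only [U]
    rw [norm_smul, Real.norm_of_nonneg hr.le]
    have h1 : ‖∑ i ∈ fib g, mcol W i‖ ≤ ∑ i ∈ fib g, r := by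
      refine norm_sum_le_of_le _ fun i _ => ?_
      rw [pi_norm_le_iff_of_nonneg hr.le]
      intro q
      exact hW.2.1 q i
    rw [Finset.sum_const, nsmul_eq_mul] at h1
    calc _ ≤ r * ((fib g).card * r) := mul_le_mul_of_nonneg_left h1 hr.le
      _ = _ := by ring
  choose S hS1 hS2 using fun g => Finset.exists_subset_card_eq (hk3 g)
  let cf : G → ℝ := fun g => (r * k g)⁻¹
  have hcf : ∀ g, 0 ≤ cf g := fun g => by simp only [cf]; positivity
  let V : Matrix (Fin d) (Fin m) ℝ := fun q i =>
    if i ∈ S (grp i) then cf (grp i) * v0 (grp i) q else 0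
  have hVin : ∀ i, i ∈ S (grp i) → mcol V i = cf (grp i) • v0 (grp i) := by
    intro i h; funext q; simp [mcol, V, h]
  have hVout : ∀ i, i ∉ S (grp i) → mcol V i = 0 := by
    intro i h; funext q; simp [mcol, V, h]
  have hCV : Cn V := by
    intro i j
    by_cases h : i ∈ S (grp i)
    · rw [hVin i h, Matrix.mulVec_smul, Pi.smul_apply, smul_eq_mul, mul_left_comm]
      have := hv0 (grp i, j)
      rw [hf] at this
      exact mul_nonneg (hcf _) this
    · rw [hVout i h]; simp
  have hUV : U V = v0 := by
    funext g
    simp only [U]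
    have h1 : ∑ i ∈ fib g, mcol V i = ∑ i ∈ S g, cf g • v0 g := by
      rw [← Finset.sum_subset (hS1 g)]
      · refine Finset.sum_congr rfl fun i hi => ?_
        have hg : grp i = g := (hmf g i).1 (hS1 g hi)
        rw [hVin i (by rw [hg]; exact hi), hg]
      · intro i hi hn
        have hg : grp i = g := (hmf g i).1 hi
        exact hVout i (by rw [hg]; exact hn)
    rw [h1, Finset.sum_const, hS2, ← Nat.cast_smul_eq_nsmul ℝ, smul_smul, smul_smul]
    by_cases h0 : k g = 0
    · have := hk1 g
      rw [h0] at this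
      have : v0 g = 0 := by
        rw [← norm_le_zero_iff]; simpa using this
      rw [this, smul_zero]
    · have h0' : (k g : ℝ) ≠ 0 := by exact_mod_cast h0
      have : r * k g * cf g = 1 := by
        simp only [cf]; field_simp
      rw [this, one_smul]
  have hVS : (V, fun i => if s i then r else -r) ∈ SS X y r m := by
    refine ⟨fun j => ?_, fun q i => ?_, hW.2.2⟩
    · rw [← hTv0, ← hUV]
      exact hout V hCV j
    · simp only [V]
      split_ifs with h
      · set g := grp i
        rw [abs_mul, abs_of_nonneg (hcf g)]
        have h1 : |v0 g q| ≤ k g * r ^ 2 := (norm_le_pi_norm (v0 g) q).trans (hk1 g)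
        calc _ ≤ cf g * (k g * r ^ 2) := mul_le_mul_of_nonneg_left h1 (hcf g)
          _ ≤ r := by
            by_cases h0 : k g = 0
            · simp [h0, hr.le]
            · have h0' : (k g : ℝ) ≠ 0 := by exact_mod_cast h0
              simp only [cf]
              apply le_of_eq
              field_simp
      · simpa using hr.le
  refine ⟨V, hVS, join_W hW hVS ?_, ?_⟩
  · intro i j
    have h1 := hCW i j
    have h2 := hCV i j
    split_ifs at h1 h2
    · left; constructor <;> linarith
    · right; constructor <;> linarith
  · have hsub : supp V ⊆ Finset.univ.biUnion S := by
      intro i hi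
      rw [Finset.mem_biUnion]
      refine ⟨grp i, Finset.mem_univ _, ?_⟩
      by_contra h
      exact mem_supp.1 hi (hVout i h)
    have h1 : (supp V).card ≤ ∑ g : G, k g := by
      refine (Finset.card_le_card hsub).trans (Finset.card_biUnion_le.trans ?_)
      exact Finset.sum_le_sum fun g _ => (hS2 g).le
    have h2 : ((supp V).card : ℝ) ≤ ∑ g : G, (k g : ℝ) := by exact_mod_cast h1
    refine h2.trans ((Finset.sum_le_sum fun g _ => hk2 g).trans ?_)
    rw [Finset.sum_const, nsmul_eq_mul, Finset.card_univ, Fintype.card_prod, Fintype.card_bool]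
    have h3 : Fintype.card Pt = Set.ncard (Set.range (pattern X)) := by
      rw [← Nat.card_eq_fintype_card]; exact Nat.card_coe_set_eq _
    rw [h3]
    push_cast
    apply le_of_eq; ring

/-- there is a constant `M > 0`, depending only on `(X, y)`, such that
`O_{‖·‖_max}(λ)` at width `m` is path-connected whenever `m ≥ 4P + 4λ²MP`; in
particular, for `m ≥ 4P + 1` it is path-connected whenever `0 < λ ≤ λ_c*(m)`. -/
theorem maxNorm_connectivity_constant {n d : ℕ}
    (X : Matrix (Fin n) (Fin d) ℝ) (y : Fin n → ℝ) :
    ∃ Mc : ℝ, 0 < Mc ∧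
      (∀ lam : ℝ, 0 < lam → ∀ m : ℕ,
        4 * (Set.ncard (Set.range (pattern X)) : ℝ) +
          4 * lam ^ 2 * Mc * (Set.ncard (Set.range (pattern X)) : ℝ) ≤ (m : ℝ) →
        ∀ A ∈ solSet (M := Fin m) X y maxNorm linfNorm lam,
          ∀ B ∈ solSet (M := Fin m) X y maxNorm linfNorm lam,
            JoinedIn (solSet (M := Fin m) X y maxNorm linfNorm lam) A B) ∧
      (∀ m : ℕ, 4 * Set.ncard (Set.range (pattern X)) + 1 ≤ m →
        ∀ lam : ℝ, 0 < lam →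
          lam ≤ Real.sqrt
            (((m : ℝ) / (4 * (Set.ncard (Set.range (pattern X)) : ℝ)) - 1) / Mc) →
          ∀ A ∈ solSet (M := Fin m) X y maxNorm linfNorm lam,
            ∀ B ∈ solSet (M := Fin m) X y maxNorm linfNorm lam,
              JoinedIn (solSet (M := Fin m) X y maxNorm linfNorm lam) A B) := by
  obtain ⟨M, hM, hred⟩ := reduce X y
  have hP : 0 < Set.ncard (Set.range (pattern X)) := by
    rw [Set.ncard_pos (Set.toFinite _)]
    exact Set.range_nonempty _
  have hPr : (0:ℝ) < (Set.ncard (Set.range (pattern X)) : ℝ) := by exact_mod_cast hP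
  have main : ∀ lam : ℝ, 0 < lam → ∀ m : ℕ,
        4 * (Set.ncard (Set.range (pattern X)) : ℝ) +
          4 * lam ^ 2 * M * (Set.ncard (Set.range (pattern X)) : ℝ) ≤ (m : ℝ) →
        ∀ A ∈ solSet (M := Fin m) X y maxNorm linfNorm lam,
          ∀ B ∈ solSet (M := Fin m) X y maxNorm linfNorm lam,
            JoinedIn (solSet (M := Fin m) X y maxNorm linfNorm lam) A B := by
    intro lam hl m hm A hA B hB
    rw [solSet_eq_SS X y lam hl m] at *
    have hr : 0 < 1 / lam := by positivity
    obtain ⟨A1, sA, hA1, jA1⟩ := join_norm hr (W := A.1) (a := A.2) hA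
    obtain ⟨B1, sB, hB1, jB1⟩ := join_norm hr (W := B.1) (a := B.2) hB
    obtain ⟨A2, hA2, jA2, cA⟩ := hred _ hr m A1 sA hA1
    obtain ⟨B2, hB2, jB2, cB⟩ := hred _ hr m B1 sB hB1
    refine (jA1.trans jA2).trans (JoinedIn.trans ?_ (jB1.trans jB2).symm)
    refine join_small hB2 _ A2 _ hA2 ?_ rfl
    have hMr : M / (1 / lam) ^ 2 = M * lam ^ 2 := by field_simp
    rw [hMr] at cA cB
    have : ((supp A2).card : ℝ) + (supp B2).card ≤ m := by nlinarith
    exact_mod_cast this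
  refine ⟨M, hM, main, ?_⟩
  intro m hm lam hl hle
  refine main lam hl m ?_
  have hm' : 4 * (Set.ncard (Set.range (pattern X)) : ℝ) + 1 ≤ m := by exact_mod_cast hm
  set P : ℝ := (Set.ncard (Set.range (pattern X)) : ℝ)
  have h1 := (Real.le_sqrt' hl).1 hle
  rw [le_div_iff₀ hM, le_sub_iff_add_le, le_div_iff₀ (by positivity)] at h1
  linarith
end

section
/- Let R₁, R₂ ∈ {entrywise max norm ‖·‖_max, Frobenius norm ‖·‖_F, operator norm ‖·‖_op}, fix a width m, fix λ₁ > 0 and Λ₂ > 0, and assume that O_{R₁}(λ₁) is nonempty and connected and that O_{R₂}(λ₂) is nonempty and connected for every λ₂ ∈ (0, Λ₂]. Then: (i) if O_{R₁}(λ₁) ∩ O_{R₂}(Λ₂) ≠ ∅, the union O_{R₁}(λ₁) ∪ O_{R₂}(λ₂) is connected for every λ₂ ∈ (0, Λ₂]; (ii) if O_{R₁}(λ₁) ∩ O_{R₂}(Λ₂) = ∅, there exists λ₂* ∈ (0, Λ₂] such that for every λ₂ ∈ (0, λ₂*] the union O_{R₁}(λ₁) ∪ O_{R₂}(λ₂)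 is connected, while for every λ₂ ∈ (λ₂*, Λ₂] the sets O_{R₁}(λ₁) and O_{R₂}(λ₂) are disjoint and are exactly the two connected components of their union. -/
open scoped BigOperators

theorem icx_linf_eq {M : Type*} [Fintype M] (v : M → ℝ) : linfNorm v = ‖v‖ := by
  apply le_antisymm
  · exact Real.iSup_le (fun i => norm_le_pi_norm v i) (norm_nonneg _)
  · refine (pi_norm_le_iff_of_nonneg (Real.iSup_nonneg fun i => abs_nonneg _)).2 fun i => ?_
    exact le_ciSup (f := fun i => |v i|) (Set.finite_range _).bddAbove i

theorem icx_l2_eq {M : Type*} [Fintype M] (v : M → ℝ) :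
    l2norm v = ‖(WithLp.toLp 2 v : EuclideanSpace ℝ M)‖ := by
  simp [l2norm, EuclideanSpace.norm_eq]

theorem icx_linf_cont {M : Type*} [Fintype M] : Continuous (linfNorm : (M → ℝ) → ℝ) := by
  have : (linfNorm : (M → ℝ) → ℝ) = fun v => ‖v‖ := funext icx_linf_eq
  rw [this]; exact continuous_norm

theorem icx_linf_bd {M : Type*} [Fintype M] (v : M → ℝ) (i : M) : |v i| ≤ linfNorm v := by
  rw [icx_linf_eq]; exact norm_le_pi_norm v i

theorem icx_l2_cont {M : Type*} [Fintype M] : Continuous (l2norm : (M → ℝ) → ℝ) := by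
  unfold l2norm; fun_prop

theorem icx_l2_bd {M : Type*} [Fintype M] (v : M → ℝ) (i : M) : |v i| ≤ l2norm v := by
  rw [icx_l2_eq]; exact PiLp.norm_apply_le (WithLp.toLp 2 v : EuclideanSpace ℝ M) i

theorem icx_max_eq {D M : Type*} [Fintype D] [Fintype M] (W : Matrix D M ℝ) :
    maxNorm W = linfNorm (fun i => linfNorm (W i)) := by
  unfold maxNorm linfNorm
  congr 1; funext i
  exact (abs_of_nonneg (Real.iSup_nonneg fun i => abs_nonneg _)).symm

theorem icx_max_cont {D M : Type*} [Fintype D] [Fintype M] :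
    Continuous (maxNorm : Matrix D M ℝ → ℝ) := by
  have : (maxNorm : Matrix D M ℝ → ℝ) = fun W => linfNorm (fun i => linfNorm (W i)) :=
    funext icx_max_eq
  rw [this]
  exact icx_linf_cont.comp (continuous_pi fun i => icx_linf_cont.comp (continuous_apply i))

theorem icx_max_bd {D M : Type*} [Fintype D] [Fintype M] (W : Matrix D M ℝ) (i : D) (j : M) :
    |W i j| ≤ maxNorm W := by
  rw [icx_max_eq]
  exact (icx_linf_bd (W i) j).trans
    ((le_abs_self _).trans (icx_linf_bd (fun i => linfNorm (W i)) i))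

theorem icx_frob_cont {D M : Type*} [Fintype D] [Fintype M] :
    Continuous (frobNorm : Matrix D M ℝ → ℝ) := by
  unfold frobNorm
  refine Real.continuous_sqrt.comp ?_
  refine continuous_finsetSum _ fun i _ => continuous_finsetSum _ fun j _ => ?_
  exact (continuous_id.matrix_elem i j).pow 2

theorem icx_frob_bd {D M : Type*} [Fintype D] [Fintype M] (W : Matrix D M ℝ) (i : D) (j : M) :
    |W i j| ≤ frobNorm W := by
  apply Real.abs_le_sqrt
  calc W i j ^ 2 ≤ ∑ j, W i j ^ 2 :=
        Finset.single_le_sum (f := fun j => W i j ^ 2) (fun _ _ => sq_nonneg _) (Finset.mem_univ j)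
    _ ≤ _ := Finset.single_le_sum (f := fun i => ∑ j, W i j ^ 2)
        (fun _ _ => Finset.sum_nonneg fun _ _ => sq_nonneg _) (Finset.mem_univ i)

open scoped Matrix.Norms.L2Operator in
theorem icx_op_eq {d m : ℕ} (W : Matrix (Fin d) (Fin m) ℝ) : opNorm W = ‖W‖ := by
  have hle : ∀ v : {v : Fin m → ℝ // l2norm v ≤ 1}, l2norm (W.mulVec v.1) ≤ ‖W‖ := by
    rintro ⟨v, hv⟩
    rw [icx_l2_eq] at hv ⊢
    refine (Matrix.l2_opNorm_mulVec W (WithLp.toLp 2 v)).trans ?_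
    exact mul_le_of_le_one_right (norm_nonneg _) hv
  have hnn : 0 ≤ opNorm W := Real.iSup_nonneg fun v => Real.sqrt_nonneg _
  apply le_antisymm
  · exact Real.iSup_le hle (norm_nonneg _)
  · rw [Matrix.l2_opNorm_def]
    refine ContinuousLinearMap.opNorm_le_of_unit_norm hnn fun x hx => ?_
    have h1 : l2norm (WithLp.ofLp x) ≤ 1 := by rw [icx_l2_eq]; exact hx.le
    have := le_ciSup (f := fun v : {v : Fin m → ℝ // l2norm v ≤ 1} => l2norm (W.mulVec v.1))
      ⟨‖W‖, by rintro _ ⟨v, rfl⟩; exact hle v⟩ ⟨WithLp.ofLp x, h1⟩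
    refine le_trans (le_of_eq ?_) this
    simp only [icx_l2_eq]
    rfl

theorem icx_op_cont {d m : ℕ} : Continuous (opNorm : Matrix (Fin d) (Fin m) ℝ → ℝ) := by
  let f : Matrix (Fin d) (Fin m) ℝ →ₗ[ℝ]
      (EuclideanSpace ℝ (Fin m) →L[ℝ] EuclideanSpace ℝ (Fin d)) :=
    (Matrix.toEuclideanLin (𝕜 := ℝ) ≪≫ₗ LinearMap.toContinuousLinearMap).toLinearMap
  have hf : Continuous f := LinearMap.continuous_of_finiteDimensional f
  have : (opNorm : Matrix (Fin d) (Fin m) ℝ → ℝ) = fun W => ‖f W‖ := by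
    funext W; rw [icx_op_eq, Matrix.l2_opNorm_def]; rfl
  rw [this]
  exact continuous_norm.comp hf

theorem icx_op_bd {d m : ℕ} (W : Matrix (Fin d) (Fin m) ℝ) (i : Fin d) (j : Fin m) :
    |W i j| ≤ opNorm W := by
  have h := icx_l2_bd (W.mulVec (Pi.single j 1)) i
  have e : W.mulVec (Pi.single j 1) i = W i j := by simp
  rw [e] at h
  refine h.trans ?_
  rw [icx_op_eq, icx_l2_eq]
  refine (Matrix.l2_opNorm_mulVec W (WithLp.toLp 2 (Pi.single j 1))).trans ?_
  simp

theorem icx_props {d m : ℕ} {R : Matrix (Fin d) (Fin m) ℝ → ℝ} {Rv : (Fin m → ℝ) → ℝ}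
    (hR : (R = maxNorm ∧ Rv = linfNorm) ∨ (R = frobNorm ∧ Rv = l2norm) ∨
           (R = opNorm ∧ Rv = l2norm)) :
    Continuous R ∧ Continuous Rv ∧ (∀ W i j, |W i j| ≤ R W) ∧ (∀ v i, |v i| ≤ Rv v) := by
  rcases hR with ⟨rfl, rfl⟩ | ⟨rfl, rfl⟩ | ⟨rfl, rfl⟩
  · exact ⟨icx_max_cont, icx_linf_cont, icx_max_bd, icx_linf_bd⟩
  · exact ⟨icx_frob_cont, icx_l2_cont, icx_frob_bd, icx_l2_bd⟩
  · exact ⟨icx_op_cont, icx_l2_cont, icx_op_bd, icx_l2_bd⟩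

theorem icx_out_cont {n d m : ℕ} (X : Matrix (Fin n) (Fin d) ℝ) :
    Continuous fun p : Matrix (Fin d) (Fin m) ℝ × (Fin m → ℝ) => nnOut X p.1 p.2 := by
  unfold nnOut
  have hr : Continuous relu := by unfold relu; fun_prop
  exact ((continuous_const.matrix_mul continuous_fst).matrix_map hr).matrix_mulVec continuous_snd

theorem icx_closed {n d m : ℕ} (X : Matrix (Fin n) (Fin d) ℝ) (y : Fin n → ℝ)
    {R : Matrix (Fin d) (Fin m) ℝ → ℝ} {Rv : (Fin m → ℝ) → ℝ}
    (hR : Continuous R) (hRv : Continuous Rv) (lam : ℝ) : IsClosed (solSet X y R Rv lam) :=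
  (isClosed_eq (icx_out_cont X) continuous_const).inter
    ((isClosed_le (hR.comp continuous_fst) continuous_const).inter
      (isClosed_le (hRv.comp continuous_snd) continuous_const))

theorem icx_compact {n d m : ℕ} (X : Matrix (Fin n) (Fin d) ℝ) (y : Fin n → ℝ)
    {R : Matrix (Fin d) (Fin m) ℝ → ℝ} {Rv : (Fin m → ℝ) → ℝ}
    (hR : Continuous R) (hRv : Continuous Rv) (hb : ∀ W i j, |W i j| ≤ R W)
    (hbv : ∀ v i, |v i| ≤ Rv v) (lam : ℝ) : IsCompact (solSet X y R Rv lam) := by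
  have hK : IsCompact (Set.univ.pi fun _ : Fin d => Set.univ.pi fun _ : Fin m =>
      Set.Icc (-(1 / lam)) (1 / lam)) :=
    isCompact_univ_pi fun _ => isCompact_univ_pi fun _ => isCompact_Icc
  have hK' : IsCompact (Set.univ.pi fun _ : Fin m => Set.Icc (-(1 / lam)) (1 / lam)) :=
    isCompact_univ_pi fun _ => isCompact_Icc
  refine IsCompact.of_isClosed_subset (hK.prod hK') (icx_closed X y hR hRv lam) ?_
  rintro ⟨W, a⟩ ⟨-, h1, h2⟩
  exact ⟨fun i _ j _ => abs_le.1 ((hb W i j).trans h1), fun i _ => abs_le.1 ((hbv a i).trans h2)⟩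

theorem icx_mono {n d m : ℕ} (X : Matrix (Fin n) (Fin d) ℝ) (y : Fin n → ℝ)
    (R : Matrix (Fin d) (Fin m) ℝ → ℝ) (Rv : (Fin m → ℝ) → ℝ) {l l' : ℝ} (hl : 0 < l)
    (h : l ≤ l') : solSet X y R Rv l' ⊆ solSet X y R Rv l := by
  rintro p ⟨h0, h1, h2⟩
  have := one_div_le_one_div_of_le hl h
  exact ⟨h0, h1.trans this, h2.trans this⟩

/-- inter-optimizer connectivity transition as `λ₂` varies. -/
theorem inter_connectivity_transition {n d m : ℕ}
    (X : Matrix (Fin n) (Fin d) ℝ) (y : Fin n → ℝ)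
    (R1 R2 : Matrix (Fin d) (Fin m) ℝ → ℝ) (Rv1 Rv2 : (Fin m → ℝ) → ℝ)
    (hR1 : (R1 = maxNorm ∧ Rv1 = linfNorm) ∨ (R1 = frobNorm ∧ Rv1 = l2norm) ∨
           (R1 = opNorm ∧ Rv1 = l2norm))
    (hR2 : (R2 = maxNorm ∧ Rv2 = linfNorm) ∨ (R2 = frobNorm ∧ Rv2 = l2norm) ∨
           (R2 = opNorm ∧ Rv2 = l2norm))
    (lam1 Lam2 : ℝ) (hlam1 : 0 < lam1) (hLam2 : 0 < Lam2)
    (h1 : IsConnected (solSet X y R1 Rv1 lam1))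
    (h2 : ∀ lam2 ∈ Set.Ioc (0 : ℝ) Lam2, IsConnected (solSet X y R2 Rv2 lam2)) :
    ((solSet X y R1 Rv1 lam1 ∩ solSet X y R2 Rv2 Lam2).Nonempty →
      ∀ lam2 ∈ Set.Ioc (0 : ℝ) Lam2,
        IsConnected (solSet X y R1 Rv1 lam1 ∪ solSet X y R2 Rv2 lam2)) ∧
    (solSet X y R1 Rv1 lam1 ∩ solSet X y R2 Rv2 Lam2 = ∅ →
      ∃ lam2s ∈ Set.Ioc (0 : ℝ) Lam2,
        (∀ lam2 ∈ Set.Ioc (0 : ℝ) lam2s,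
          IsConnected (solSet X y R1 Rv1 lam1 ∪ solSet X y R2 Rv2 lam2)) ∧
        (∀ lam2 ∈ Set.Ioc lam2s Lam2,
          solSet X y R1 Rv1 lam1 ∩ solSet X y R2 Rv2 lam2 = ∅ ∧
          ∀ C : Set (Matrix (Fin d) (Fin m) ℝ × (Fin m → ℝ)),
            C ⊆ solSet X y R1 Rv1 lam1 ∪ solSet X y R2 Rv2 lam2 → IsPreconnected C →
              C ⊆ solSet X y R1 Rv1 lam1 ∨ C ⊆ solSet X y R2 Rv2 lam2)) := by
  obtain ⟨c1, cv1, b1, bv1⟩ := icx_props hR1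
  obtain ⟨c2, cv2, b2, bv2⟩ := icx_props hR2
  constructor
  · rintro ⟨p, hp1, hp2⟩ l hl
    exact IsConnected.union ⟨p, hp1, icx_mono X y R2 Rv2 hl.1 hl.2 hp2⟩ h1 (h2 l hl)
  · intro hemp
    obtain ⟨p, hp, hmin⟩ := (icx_compact X y c1 cv1 b1 bv1 lam1).exists_isMinOn h1.nonempty
      (f := fun p => max (R2 p.1) (Rv2 p.2))
      ((c2.comp continuous_fst).max (cv2.comp continuous_snd)).continuousOn
    set g := max (R2 p.1) (Rv2 p.2) with hg
    have hgl : 1 / Lam2 < g := by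
      by_contra hcon
      have hcon := max_le_iff.1 (not_lt.1 hcon)
      have : p ∈ solSet X y R1 Rv1 lam1 ∩ solSet X y R2 Rv2 Lam2 :=
        ⟨hp, hp.1, hcon.1, hcon.2⟩
      rw [hemp] at this
      exact this
    have hgpos : 0 < g := (one_div_pos.2 hLam2).trans hgl
    have hsle : 1 / g ≤ Lam2 := ((one_div_lt hLam2 hgpos).1 hgl).le
    refine ⟨1 / g, ⟨one_div_pos.2 hgpos, hsle⟩, ?_, ?_⟩
    · intro l hl
      have hgle : g ≤ 1 / l := (le_one_div hl.1 hgpos).1 hl.2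
      have hgle' := max_le_iff.1 hgle
      exact IsConnected.union ⟨p, hp, hp.1, hgle'.1, hgle'.2⟩ h1 (h2 l ⟨hl.1, hl.2.trans hsle⟩)
    · intro l hl
      have hlpos : 0 < l := (one_div_pos.2 hgpos).trans hl.1
      have hdis : solSet X y R1 Rv1 lam1 ∩ solSet X y R2 Rv2 l = ∅ := by
        rw [Set.eq_empty_iff_forall_notMem]
        rintro q ⟨hq1, -, hq2, hq3⟩
        have h3 : g ≤ max (R2 q.1) (Rv2 q.2) := hmin hq1
        have h4 := h3.trans (max_le hq2 hq3)
        exact absurd hl.1 (not_lt.2 ((le_one_div hgpos hlpos).1 h4))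
      refine ⟨hdis, fun C hC hpc => ?_⟩
      refine isPreconnected_iff_subset_of_disjoint_closed.1 hpc _ _ (icx_closed X y c1 cv1 lam1)
        (icx_closed X y c2 cv2 l) hC ?_
      rw [hdis, Set.inter_empty]
end

section
/- Let A ∈ ℝ^{d×d} be invertible, let X = [A; −A] ∈ ℝ^{2d×d} be the vertical stack of A and −A, and let y ∈ ℝ^{2d} have all entries strictly positive. Then for every (W, α) ∈ ℝ^{d×2} × ℝ² with (XW)_+ α = y, one has A_{i·} W_{·j} ≠ 0 for every i ∈ {1,…,d} and j ∈ {1, 2}, where A_{i·} is the i-th row of A and W_{·j} the j-th column of W. -/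
open scoped BigOperators

/-- for `X = [A; -A]` with `A` invertible and `y > 0` entrywise, every
width-2 zero-loss solution satisfies `A_{i·} W_{·j} ≠ 0` for all `i, j`. -/
theorem no_dead_row {d : ℕ} (A : Matrix (Fin d) (Fin d) ℝ) (hA : IsUnit A.det)
    (y : (Fin d ⊕ Fin d) → ℝ) (hy : ∀ i, 0 < y i)
    (W : Matrix (Fin d) (Fin 2) ℝ) (a : Fin 2 → ℝ)
    (h : nnOut (Matrix.fromRows A (-A)) W a = y) :
    ∀ (i : Fin d) (j : Fin 2), A.mulVec (mcol W j) i ≠ 0 := by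
  intro i j hj
  have e : ∀ k, (A * W) i k = A.mulVec (mcol W k) i := fun k => rfl
  have h1 := hy (Sum.inl i)
  have h2 := hy (Sum.inr i)
  rw [← h] at h1 h2
  simp only [nnOut, Matrix.fromRows_mul, Matrix.mulVec, dotProduct, Fin.sum_univ_two,
    Matrix.map_apply, Matrix.fromRows_apply_inl, Matrix.fromRows_apply_inr,
    Matrix.neg_mul, Matrix.neg_apply] at h1 h2
  rw [← e] at hj
  have key : ∀ u b : ℝ, 0 < relu u * b → 0 < relu (-u) * b → False := by
    intro u b p q
    unfold relu at p q
    rcases le_total u 0 with hu | hu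
    · rw [max_eq_right hu] at p
      simp at p
    · rw [max_eq_right (by linarith : -u ≤ 0)] at q
      simp at q
  have z : relu 0 = 0 := by simp [relu]
  fin_cases j
  · simp only [Fin.zero_eta] at hj
    rw [hj] at h1 h2
    simp only [neg_zero, z, zero_mul, zero_add] at h1 h2
    exact key _ _ h1 h2
  · simp only [Fin.mk_one] at hj
    rw [hj] at h1 h2
    simp only [neg_zero, z, zero_mul, add_zero] at h1 h2
    exact key _ _ h1 h2
end

section
/- For p, q ∈ ℝ^d, define C(p, q) = {(W, α) : α = (α₁, α₂) with α₁ > 0, α₂ > 0, W = [p/α₁, q/α₂] ∈ ℝ^{d×2}}. Then the infimum over (W, α) ∈ C(p, q) of max{‖W‖_op, ‖α‖₂} equals (‖p‖₂² + ‖q‖₂² + 2|⟨p, q⟩|)^{1/4}, which also equals max{‖p + q‖₂, ‖p − q‖₂}^{1/2}. Here ‖W‖_op is the operator norm (largest singular value) of W and ‖·‖₂ the Euclidean norm. -/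
open scoped BigOperators

/-- The set `C(p, q) = {([p/α₁, q/α₂], (α₁, α₂)) : α₁, α₂ > 0}`. -/
def Cpq {d : ℕ} (p q : Fin d → ℝ) : Set (Matrix (Fin d) (Fin 2) ℝ × (Fin 2 → ℝ)) :=
  {Wa | 0 < Wa.2 0 ∧ 0 < Wa.2 1 ∧
        (∀ r, Wa.1 r 0 = p r / Wa.2 0) ∧ (∀ r, Wa.1 r 1 = q r / Wa.2 1)}

lemma le_of_sqle {a b : ℝ} (h : a ^ 2 ≤ b ^ 2) (hb : 0 ≤ b) : a ≤ b := (le_abs_self a).trans (abs_le_of_sq_le_sq h hb)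

lemma l2sq {M : Type*} [Fintype M] (v : M → ℝ) : l2norm v ^ 2 = ∑ i, (v i) ^ 2 :=
  Real.sq_sqrt (Finset.sum_nonneg fun _ _ => sq_nonneg _)

lemma l2nn {M : Type*} [Fintype M] (v : M → ℝ) : 0 ≤ l2norm v := Real.sqrt_nonneg _

lemma comb_sq {d : ℕ} (p q : Fin d → ℝ) (u w : ℝ) :
    ∑ i, (p i * u + q i * w) ^ 2 =
      l2norm p ^ 2 * u ^ 2 + l2norm q ^ 2 * w ^ 2 + 2 * (∑ i, p i * q i) * (u * w) := by
  rw [l2sq, l2sq, Finset.sum_mul, Finset.sum_mul, Finset.mul_sum, Finset.sum_mul,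
    ← Finset.sum_add_distrib, ← Finset.sum_add_distrib]
  exact Finset.sum_congr rfl fun i _ => by ring

lemma comb_le {d : ℕ} (p q : Fin d → ℝ) (u w : ℝ) :
    ∑ i, (p i * u + q i * w) ^ 2 ≤
      (l2norm p ^ 2 + |∑ i, p i * q i|) * u ^ 2 + (l2norm q ^ 2 + |∑ i, p i * q i|) * w ^ 2 := by
  rw [comb_sq]
  have h1 : (∑ i, p i * q i) ≤ |∑ i, p i * q i| := le_abs_self _
  have h2 : -(∑ i, p i * q i) ≤ |∑ i, p i * q i| := neg_le_abs _
  generalize (∑ i, p i * q i) = c at *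
  generalize |c| = e at *
  nlinarith [mul_nonneg (sub_nonneg.2 h1) (sq_nonneg (u + w)),
    mul_nonneg (sub_nonneg.2 h2) (sq_nonneg (u - w))]

lemma mulVec_sq {d : ℕ} {p q : Fin d → ℝ} {Wa : Matrix (Fin d) (Fin 2) ℝ × (Fin 2 → ℝ)}
    (h : Wa ∈ Cpq p q) (v : Fin 2 → ℝ) :
    l2norm (Wa.1.mulVec v) ^ 2 = ∑ i, (p i * (v 0 / Wa.2 0) + q i * (v 1 / Wa.2 1)) ^ 2 := by
  obtain ⟨_, _, h1, h2⟩ := h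
  rw [l2sq]
  refine Finset.sum_congr rfl fun i _ => ?_
  simp only [Matrix.mulVec, dotProduct, Fin.sum_univ_two, h1, h2]
  ring

lemma op_bdd {d : ℕ} {p q : Fin d → ℝ} {Wa : Matrix (Fin d) (Fin 2) ℝ × (Fin 2 → ℝ)}
    (h : Wa ∈ Cpq p q) {K : ℝ} (hK : 0 ≤ K)
    (h0 : l2norm p ^ 2 + |∑ i, p i * q i| ≤ K ^ 2 * Wa.2 0 ^ 2)
    (h1 : l2norm q ^ 2 + |∑ i, p i * q i| ≤ K ^ 2 * Wa.2 1 ^ 2)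
    (v : {v : Fin 2 → ℝ // l2norm v ≤ 1}) : l2norm (Wa.1.mulVec v.1) ≤ K := by
  have hv : l2norm v.1 ^ 2 ≤ 1 := pow_le_one₀ (l2nn _) v.2
  rw [l2sq, Fin.sum_univ_two] at hv
  refine le_of_sqle ?_ hK
  rw [mulVec_sq h]
  refine (comb_le _ _ _ _).trans ?_
  have a0 := h.1
  have a1 := h.2.1
  calc _ ≤ K ^ 2 * Wa.2 0 ^ 2 * (v.1 0 / Wa.2 0) ^ 2 + K ^ 2 * Wa.2 1 ^ 2 * (v.1 1 / Wa.2 1) ^ 2 := by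
        gcongr
    _ = K ^ 2 * (v.1 0 ^ 2 + v.1 1 ^ 2) := by field_simp
    _ ≤ K ^ 2 := mul_le_of_le_one_right (sq_nonneg _) hv

lemma op_bddAbove {d : ℕ} {p q : Fin d → ℝ} {Wa : Matrix (Fin d) (Fin 2) ℝ × (Fin 2 → ℝ)}
    (h : Wa ∈ Cpq p q) : BddAbove (Set.range
      fun v : {v : Fin 2 → ℝ // l2norm v ≤ 1} => l2norm (Wa.1.mulVec v.1)) := by
  have a0 := h.1
  have a1 := h.2.1
  set A := (l2norm p ^ 2 + |∑ i, p i * q i|) / Wa.2 0 ^ 2 with hA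
  set B := (l2norm q ^ 2 + |∑ i, p i * q i|) / Wa.2 1 ^ 2 with hB
  have hA0 : 0 ≤ A := by positivity
  have hB0 : 0 ≤ B := by positivity
  refine ⟨Real.sqrt (A + B), ?_⟩
  rintro _ ⟨v, rfl⟩
  refine op_bdd h (Real.sqrt_nonneg _) ?_ ?_ v
  · rw [Real.sq_sqrt (by positivity), ← div_le_iff₀ (by positivity)]
    linarith
  · rw [Real.sq_sqrt (by positivity), ← div_le_iff₀ (by positivity)]
    linarith

lemma lower {d : ℕ} {p q : Fin d → ℝ} {Wa : Matrix (Fin d) (Fin 2) ℝ × (Fin 2 → ℝ)}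
    (h : Wa ∈ Cpq p q) (s : ℝ) (hs : s ^ 2 = 1) :
    l2norm p ^ 2 + l2norm q ^ 2 + 2 * (∑ i, p i * q i) * s ≤
      (max (opNorm Wa.1) (l2norm Wa.2)) ^ 4 := by
  have a0 := h.1
  have a1 := h.2.1
  have hN := l2sq Wa.2
  rw [Fin.sum_univ_two] at hN
  have hN0 : 0 < l2norm Wa.2 := by
    refine lt_of_le_of_ne (l2nn _) fun h0 => ?_
    rw [← h0] at hN
    nlinarith
  set N := l2norm Wa.2
  let v : Fin 2 → ℝ := ![Wa.2 0 / N, s * Wa.2 1 / N]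
  have hv : l2norm v ≤ 1 := by
    refine le_of_sqle ?_ zero_le_one
    rw [l2sq, Fin.sum_univ_two]
    simp only [v, Matrix.cons_val_zero, Matrix.cons_val_one]
    rw [div_pow, div_pow, mul_pow, hs, ← add_div, one_mul, ← hN, div_self (by positivity)]
    norm_num
  have hop : l2norm (Wa.1.mulVec v) ≤ opNorm Wa.1 := le_ciSup (op_bddAbove h) ⟨v, hv⟩
  have e : l2norm (Wa.1.mulVec v) ^ 2 * N ^ 2 =
      l2norm p ^ 2 + l2norm q ^ 2 + 2 * (∑ i, p i * q i) * s := by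
    rw [mulVec_sq h, comb_sq]
    simp only [v, Matrix.cons_val_zero, Matrix.cons_val_one]
    field_simp
    rw [hs]; ring
  rw [← e]
  have h1 := hop.trans (le_max_left (opNorm Wa.1) N)
  have h2 := le_max_right (opNorm Wa.1) N
  have h3 := l2nn (Wa.1.mulVec v)
  calc _ ≤ (max (opNorm Wa.1) N) ^ 2 * (max (opNorm Wa.1) N) ^ 2 := by gcongr
    _ = _ := by ring

lemma upper {d : ℕ} (p q : Fin d → ℝ) {K : ℝ} (hK : 0 < K)
    (h : l2norm p ^ 2 + l2norm q ^ 2 + 2 * |∑ i, p i * q i| < K ^ 4) :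
    ∃ Wa ∈ Cpq p q, max (opNorm Wa.1) (l2norm Wa.2) ≤ K := by
  set c := |∑ i, p i * q i| with hc
  have hc0 : 0 ≤ c := abs_nonneg _
  obtain ⟨e, he⟩ : ∃ e, e = (K ^ 4 - (l2norm p ^ 2 + l2norm q ^ 2 + 2 * c)) / 2 := ⟨_, rfl⟩
  have he0 : 0 < e := by linarith
  have ha : 0 < (l2norm p ^ 2 + c + e) / K ^ 2 := by positivity
  have hb : 0 < (l2norm q ^ 2 + c + e) / K ^ 2 := by positivity
  let x := Real.sqrt ((l2norm p ^ 2 + c + e) / K ^ 2)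
  let y := Real.sqrt ((l2norm q ^ 2 + c + e) / K ^ 2)
  have hx : x ^ 2 = (l2norm p ^ 2 + c + e) / K ^ 2 := Real.sq_sqrt ha.le
  have hy : y ^ 2 = (l2norm q ^ 2 + c + e) / K ^ 2 := Real.sq_sqrt hb.le
  have hm : ((Matrix.of fun r => ![p r / x, q r / y], ![x, y]) :
      Matrix (Fin d) (Fin 2) ℝ × (Fin 2 → ℝ)) ∈ Cpq p q :=
    ⟨Real.sqrt_pos.2 ha, Real.sqrt_pos.2 hb, fun r => by simp, fun r => by simp⟩
  refine ⟨_, hm, max_le ?_ ?_⟩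
  · have : Nonempty {v : Fin 2 → ℝ // l2norm v ≤ 1} := ⟨⟨0, by simp [l2norm]⟩⟩
    refine ciSup_le fun v => op_bdd hm hK.le ?_ ?_ v
    · simp only [Matrix.cons_val_zero]
      rw [hx, mul_div_cancel₀ _ (by positivity)]
      linarith
    · simp only [Matrix.cons_val_one, Matrix.cons_val_zero]
      rw [hy, mul_div_cancel₀ _ (by positivity)]
      linarith
  · refine le_of_sqle ?_ hK.le
    rw [l2sq, Fin.sum_univ_two]
    simp only [Matrix.cons_val_zero, Matrix.cons_val_one]
    rw [hx, hy, ← add_div, div_le_iff₀ (by positivity)]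
    apply le_of_eq
    rw [he]; ring

/-- `inf_{(W,α) ∈ C(p,q)} max{‖W‖_op, ‖α‖₂}
    = (‖p‖₂² + ‖q‖₂² + 2|⟨p,q⟩|)^{1/4} = max{‖p+q‖₂, ‖p−q‖₂}^{1/2}`. -/
theorem Cpq_inf_opNorm {d : ℕ} (p q : Fin d → ℝ) :
    sInf {r : ℝ | ∃ Wa ∈ Cpq p q, r = max (opNorm Wa.1) (l2norm Wa.2)} =
        (l2norm p ^ 2 + l2norm q ^ 2 + 2 * |∑ i, p i * q i|) ^ ((1 : ℝ) / 4) ∧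
      (l2norm p ^ 2 + l2norm q ^ 2 + 2 * |∑ i, p i * q i|) ^ ((1 : ℝ) / 4) =
        Real.sqrt (max (l2norm (p + q)) (l2norm (p - q))) := by
  set S := l2norm p ^ 2 + l2norm q ^ 2 + 2 * |∑ i, p i * q i| with hS
  have hS0 : 0 ≤ S := by positivity
  have hp : l2norm (p + q) ^ 2 = l2norm p ^ 2 + l2norm q ^ 2 + 2 * (∑ i, p i * q i) := by
    have := comb_sq p q 1 1
    rw [l2sq (p + q)]
    simpa using this
  have hq : l2norm (p - q) ^ 2 = l2norm p ^ 2 + l2norm q ^ 2 - 2 * (∑ i, p i * q i) := by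
    have := comb_sq p q 1 (-1)
    rw [l2sq (p - q)]
    simpa [sub_eq_add_neg] using this
  have hmax : (max (l2norm (p + q)) (l2norm (p - q))) ^ 2 = S := by
    have n1 := l2nn (p + q)
    have n2 := l2nn (p - q)
    rcases le_total 0 (∑ i, p i * q i) with h | h
    · rw [max_eq_left (le_of_sqle (by linarith) n1), hp, hS, abs_of_nonneg h]
    · rw [max_eq_right (le_of_sqle (by linarith) n2), hq, hS, abs_of_nonpos h]
      ring
  have hm0 : 0 ≤ S ^ ((1 : ℝ) / 4) := Real.rpow_nonneg hS0 _
  have hm4 : (S ^ ((1 : ℝ) / 4)) ^ 4 = S := by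
    rw [← Real.rpow_natCast, ← Real.rpow_mul hS0]; norm_num
  set m := S ^ ((1 : ℝ) / 4)
  have key : ∀ r ∈ {r : ℝ | ∃ Wa ∈ Cpq p q, r = max (opNorm Wa.1) (l2norm Wa.2)}, m ≤ r := by
    rintro _ ⟨Wa, h, rfl⟩
    have hr : 0 ≤ max (opNorm Wa.1) (l2norm Wa.2) := (l2nn _).trans (le_max_right _ _)
    refine (pow_le_pow_iff_left₀ hm0 hr (n := 4) (by norm_num)).1 ?_
    rw [hm4]
    have l1 := lower h 1 (by norm_num)
    have l2 := lower h (-1) (by norm_num)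
    rcases abs_cases (∑ i, p i * q i) with ⟨h, _⟩ | ⟨h, _⟩ <;> rw [hS, h] <;> linarith
  constructor
  · apply le_antisymm
    · refine le_of_forall_gt_imp_ge_of_dense fun K hK => ?_
      obtain ⟨Wa, h, hle⟩ := upper p q (hm0.trans_lt hK)
        (by rw [← hS, ← hm4]; exact pow_lt_pow_left₀ hK hm0 (by norm_num))
      exact (csInf_le ⟨m, key⟩ ⟨Wa, h, rfl⟩).trans hle
    · obtain ⟨Wa, h, _⟩ := upper p q (K := m + 1) (by positivity)
        (by rw [← hS, ← hm4]; exact pow_lt_pow_left₀ (by linarith) hm0 (by norm_num))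
      exact le_csInf ⟨_, Wa, h, rfl⟩ key
  · refine (pow_left_inj₀ hm0 (Real.sqrt_nonneg _) (n := 4) (by norm_num)).1 ?_
    rw [hm4, ← hmax, show (4 : ℕ) = 2 * 2 from rfl, pow_mul,
      Real.sq_sqrt ((l2nn _).trans (le_max_left _ _))]
end

section
/- Let p, q ∈ ℝ^d be nonzero vectors and set a = ‖p‖₂², b = ‖q‖₂², c = ⟨p, q⟩, and s* = (a + |c|)/(a + b + 2|c|). Then s* ∈ (0, 1), the largest eigenvalue of the symmetric matrix (1/s*) p pᵀ + (1/(1 − s*)) q qᵀ equals a + b + 2|c|, and for every s ∈ (0, 1) the largest eigenvalue of (1/s) p pᵀ + (1/(1 − s)) q qᵀ is at least a + b + 2|c|; hence inf_{s ∈ (0,1)} λ_max((1/s) p pᵀ + (1/(1 − s)) q qᵀ) = a + b + 2|c|. -/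
open scoped BigOperators

/-- Largest eigenvalue of a real symmetric matrix, as the supremum of the Rayleigh
quotient over the Euclidean unit sphere. -/
noncomputable def lamMax {d : ℕ} (M : Matrix (Fin d) (Fin d) ℝ) : ℝ :=
  ⨆ v : {v : Fin d → ℝ // ∑ i, v i ^ 2 = 1}, ∑ i, v.1 i * M.mulVec v.1 i

/-- The matrix `(1/s) p pᵀ + (1/(1-s)) q qᵀ`. -/
noncomputable def rayM {d : ℕ} (p q : Fin d → ℝ) (s : ℝ) : Matrix (Fin d) (Fin d) ℝ :=
  (1 / s) • Matrix.vecMulVec p p + (1 / (1 - s)) • Matrix.vecMulVec q q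

theorem ray_form {d : ℕ} (p q v : Fin d → ℝ) (s : ℝ) :
    ∑ i, v i * (rayM p q s).mulVec v i
      = (∑ i, p i * v i) ^ 2 / s + (∑ i, q i * v i) ^ 2 / (1 - s) := by
  have e : ∀ i, (rayM p q s).mulVec v i
      = (1 / s) * (p i * ∑ j, p j * v j) + (1 / (1 - s)) * (q i * ∑ j, q j * v j) := by
    intro i
    simp only [rayM, Matrix.mulVec, dotProduct, Matrix.add_apply, Matrix.smul_apply,
      Matrix.vecMulVec_apply, smul_eq_mul, Finset.mul_sum, ← Finset.sum_add_distrib]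
    refine Finset.sum_congr rfl fun j _ => ?_
    ring
  simp only [e]
  generalize hx : ∑ j, p j * v j = x
  generalize hy : ∑ j, q j * v j = y
  have : ∀ i, v i * ((1 / s) * (p i * x) + (1 / (1 - s)) * (q i * y))
      = (x / s) * (p i * v i) + (y / (1 - s)) * (q i * v i) := by
    intro i; ring
  simp only [this, Finset.sum_add_distrib, ← Finset.mul_sum, hx, hy]
  ring

theorem ray_bdd {d : ℕ} (p q : Fin d → ℝ) (s : ℝ) (hs : 0 < s) (hs1 : s < 1) :
    BddAbove (Set.range fun v : {v : Fin d → ℝ // ∑ i, v i ^ 2 = 1} =>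
      ∑ i, v.1 i * (rayM p q s).mulVec v.1 i) := by
  refine ⟨(∑ i, p i ^ 2) / s + (∑ i, q i ^ 2) / (1 - s), ?_⟩
  rintro _ ⟨⟨v, hv⟩, rfl⟩
  have h1 := Finset.sum_mul_sq_le_sq_mul_sq Finset.univ p v
  have h2 := Finset.sum_mul_sq_le_sq_mul_sq Finset.univ q v
  rw [hv, mul_one] at h1 h2
  have : 0 < 1 - s := by linarith
  simp only [ray_form]
  gcongr

theorem ray_lower {d : ℕ} (p q : Fin d → ℝ) (hp : 0 < ∑ i, p i ^ 2) (hq : 0 < ∑ i, q i ^ 2)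
    (s : ℝ) (hs : 0 < s) (hs1 : s < 1) :
    ∑ i, p i ^ 2 + ∑ i, q i ^ 2 + 2 * |∑ i, p i * q i| ≤ lamMax (rayM p q s) := by
  obtain ⟨e, he, hec⟩ : ∃ e : ℝ, e ^ 2 = 1 ∧ e * (∑ i, p i * q i) = |∑ i, p i * q i| := by
    rcases abs_cases (∑ i, p i * q i) with h | h
    · exact ⟨1, by norm_num, by rw [h.1]; ring⟩
    · exact ⟨-1, by norm_num, by rw [h.1]; ring⟩
  have hc := abs_nonneg (∑ i, p i * q i)
  set a := ∑ i, p i ^ 2 with ha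
  set b := ∑ i, q i ^ 2 with hb
  set c := ∑ i, p i * q i with hcd
  set N := a + b + 2 * |c| with hN
  have hN0 : 0 < N := by linarith
  set r := Real.sqrt N with hr
  have hr0 : 0 < r := Real.sqrt_pos.2 hN0
  have hr2 : r ^ 2 = N := Real.sq_sqrt hN0.le
  have hw : ∑ i, ((p i + e * q i) / r) ^ 2 = 1 := by
    have : ∀ i, ((p i + e * q i) / r) ^ 2
        = (p i ^ 2 + q i ^ 2 + (2 * e) * (p i * q i)) * (1 / N) := by
      intro i
      rw [div_pow, hr2]
      linear_combination (q i ^ 2 / N) * he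
    simp only [this, ← Finset.sum_mul, Finset.sum_add_distrib, ← Finset.mul_sum]
    rw [← ha, ← hb, ← hcd, mul_assoc, hec, ← hN]
    field_simp
  refine le_trans ?_ (le_ciSup (ray_bdd p q s hs hs1) ⟨fun i => (p i + e * q i) / r, hw⟩)
  simp only [ray_form]
  have hx : ∑ i, p i * ((p i + e * q i) / r) = (a + |c|) / r := by
    have : ∀ i, p i * ((p i + e * q i) / r) = (p i ^ 2 + e * (p i * q i)) / r := by
      intro i; ring
    simp only [this, ← Finset.sum_div, Finset.sum_add_distrib, ← Finset.mul_sum]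
    rw [← ha, ← hcd, hec]
  have hy : ∑ i, q i * ((p i + e * q i) / r) = e * (b + |c|) / r := by
    have : ∀ i, q i * ((p i + e * q i) / r) = (p i * q i + e * q i ^ 2) / r := by
      intro i; ring
    simp only [this, ← Finset.sum_div, Finset.sum_add_distrib, ← Finset.mul_sum]
    rw [← hb, ← hcd, ← hec]
    congr 1
    linear_combination (-c) * he
  rw [hx, hy, div_pow, div_pow, mul_pow, he, hr2, one_mul]
  have h1 : 0 < 1 - s := by linarith
  have key : N = (a + |c|) + (b + |c|) := by rw [hN]; ring
  generalize a + |c| = A at *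
  generalize b + |c| = B at *
  have : A ^ 2 / N / s + B ^ 2 / N / (1 - s) - N
      = ((1 - s) * A - s * B) ^ 2 / (N * s * (1 - s)) := by
    have : A ^ 2 / N / s + B ^ 2 / N / (1 - s) - N
      = (A ^ 2 * (1 - s) + B ^ 2 * s - N ^ 2 * s * (1 - s)) / (N * s * (1 - s)) := by
      field_simp
    rw [this]
    congr 1
    rw [key]; ring
  have h2 : 0 ≤ ((1 - s) * A - s * B) ^ 2 / (N * s * (1 - s)) := by positivity
  linarith

theorem ray_upper {d : ℕ} (p q v : Fin d → ℝ) (hp : 0 < ∑ i, p i ^ 2) (hq : 0 < ∑ i, q i ^ 2)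
    (hv : ∑ i, v i ^ 2 = 1) :
    (∑ i, p i * v i) ^ 2 / (∑ i, p i ^ 2 + |∑ i, p i * q i|)
      + (∑ i, q i * v i) ^ 2 / (∑ i, q i ^ 2 + |∑ i, p i * q i|) ≤ 1 := by
  have hc := abs_nonneg (∑ i, p i * q i)
  have hexp : ∀ α β : ℝ, ∑ i, (v i - α * p i - β * q i) ^ 2
      = 1 + α ^ 2 * (∑ i, p i ^ 2) + β ^ 2 * (∑ i, q i ^ 2) + (2 * α * β) * (∑ i, p i * q i)
        - (2 * α) * (∑ i, p i * v i) - (2 * β) * (∑ i, q i * v i) := by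
    intro α β
    rw [← hv]
    simp only [Finset.mul_sum, ← Finset.sum_add_distrib, ← Finset.sum_sub_distrib]
    refine Finset.sum_congr rfl fun j _ => ?_
    ring
  generalize (∑ i, p i ^ 2) = a at *
  generalize (∑ i, q i ^ 2) = b at *
  generalize (∑ i, p i * q i) = c at *
  generalize (∑ i, p i * v i) = x at *
  generalize (∑ i, q i * v i) = y at *
  have hA : 0 < a + |c| := by linarith
  have hB : 0 < b + |c| := by linarith
  obtain ⟨α, hα⟩ : ∃ α, α = x / (a + |c|) := ⟨_, rfl⟩
  obtain ⟨β, hβ⟩ : ∃ β, β = y / (b + |c|) := ⟨_, rfl⟩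
  have hx : x = α * (a + |c|) := by rw [hα]; field_simp
  have hy : y = β * (b + |c|) := by rw [hβ]; field_simp
  have h0 : 0 ≤ ∑ i, (v i - α * p i - β * q i) ^ 2 := Finset.sum_nonneg fun i _ => sq_nonneg _
  rw [hexp] at h0
  have e1 : x ^ 2 / (a + |c|) = α ^ 2 * (a + |c|) := by rw [hx]; field_simp
  have e2 : y ^ 2 / (b + |c|) = β ^ 2 * (b + |c|) := by rw [hy]; field_simp
  rw [e1, e2]
  rw [hx, hy] at h0
  have h3 : 2 * α * β * c ≤ (α ^ 2 + β ^ 2) * |c| := by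
    rcases abs_cases c with h | h
    · rw [h.1]; nlinarith [mul_nonneg h.2 (sq_nonneg (α - β))]
    · rw [h.1]; nlinarith [mul_nonneg (neg_nonneg.2 h.2.le) (sq_nonneg (α + β))]
  nlinarith

theorem sumsq_pos {d : ℕ} (p : Fin d → ℝ) (hp : p ≠ 0) : 0 < ∑ i, p i ^ 2 := by
  obtain ⟨i, hi⟩ := Function.ne_iff.1 hp
  exact Finset.sum_pos' (fun i _ => sq_nonneg _) ⟨i, Finset.mem_univ _, by
    have : p i ≠ 0 := hi
    positivity⟩

/-- with `a = ‖p‖₂²`, `b = ‖q‖₂²`, `c = ⟨p,q⟩` and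
`s* = (a + |c|)/(a + b + 2|c|)`, one has `s* ∈ (0,1)`,
`λ_max((1/s*) p pᵀ + (1/(1−s*)) q qᵀ) = a + b + 2|c|`, this value is a lower bound of
`λ_max((1/s) p pᵀ + (1/(1−s)) q qᵀ)` for all `s ∈ (0,1)`, and hence the infimum over
`s ∈ (0,1)` equals `a + b + 2|c|`. -/
theorem rayleigh_min_over_split {d : ℕ} (p q : Fin d → ℝ) (hp : p ≠ 0) (hq : q ≠ 0) :
    let a : ℝ := ∑ i, p i ^ 2
    let b : ℝ := ∑ i, q i ^ 2
    let c : ℝ := ∑ i, p i * q i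
    let sstar : ℝ := (a + |c|) / (a + b + 2 * |c|)
    0 < sstar ∧ sstar < 1 ∧
    lamMax (rayM p q sstar) = a + b + 2 * |c| ∧
    (∀ s ∈ Set.Ioo (0 : ℝ) 1, a + b + 2 * |c| ≤ lamMax (rayM p q s)) ∧
    sInf {r : ℝ | ∃ s ∈ Set.Ioo (0 : ℝ) 1, r = lamMax (rayM p q s)} = a + b + 2 * |c| := by
  intro a b c sstar
  have ha : 0 < a := sumsq_pos p hp
  have hb : 0 < b := sumsq_pos q hq
  have hc : 0 ≤ |c| := abs_nonneg c
  have hN : 0 < a + b + 2 * |c| := by linarith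
  have h0 : 0 < sstar := div_pos (by linarith) hN
  have h1 : sstar < 1 := by
    rw [div_lt_one hN]; linarith
  have hlow : ∀ s ∈ Set.Ioo (0 : ℝ) 1, a + b + 2 * |c| ≤ lamMax (rayM p q s) :=
    fun s hs => ray_lower p q ha hb s hs.1 hs.2
  have hA : 0 < a + |c| := by linarith
  have hB : 0 < b + |c| := by linarith
  have hne : Nonempty {v : Fin d → ℝ // ∑ i, v i ^ 2 = 1} := by
    refine ⟨⟨fun i => p i / Real.sqrt a, ?_⟩⟩
    simp only [div_pow, Real.sq_sqrt ha.le, ← Finset.sum_div]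
    exact div_self ha.ne'
  have heq : lamMax (rayM p q sstar) = a + b + 2 * |c| := by
    refine le_antisymm ?_ (hlow _ ⟨h0, h1⟩)
    refine ciSup_le ?_
    rintro ⟨v, hv⟩
    simp only [ray_form]
    have hu := ray_upper p q v ha hb hv
    have hs : 1 - sstar = (b + |c|) / (a + b + 2 * |c|) := by
      rw [eq_div_iff hN.ne', sub_mul, div_mul_cancel₀ _ hN.ne']; ring
    rw [hs]
    calc _ = (a + b + 2 * |c|) * ((∑ i, p i * v i) ^ 2 / (a + |c|)
          + (∑ i, q i * v i) ^ 2 / (b + |c|)) := by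
            simp only [sstar, div_div_eq_mul_div]; ring
      _ ≤ (a + b + 2 * |c|) * 1 := mul_le_mul_of_nonneg_left hu hN.le
      _ = _ := mul_one _
  refine ⟨h0, h1, heq, hlow, ?_⟩
  refine IsLeast.csInf_eq ⟨⟨sstar, ⟨h0, h1⟩, heq.symm⟩, ?_⟩
  rintro r ⟨s, hs, rfl⟩
  exact hlow s hs
end

section
/- Let A ∈ ℝ^{d×d} be invertible, X = [A; −A] ∈ ℝ^{2d×d}, and y = 𝟏_{2d} the all-ones vector. For σ ∈ {±1}^d, the component C_{σ|−σ} equals C(A^{-1}σ, −A^{-1}σ), and: (i) the infimum over (W, α) ∈ C_{σ|−σ} of max{‖W‖_max, ‖α‖_∞} equals ‖A^{-1}σ‖_∞^{1/2}; (ii) the infimum over (W, α) ∈ C_{σ|−σ} of max{‖W‖_op, ‖α‖₂} equals (2‖A^{-1}σ‖₂)^{1/2}. -/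
open scoped BigOperators

/-- `y_σ ∈ ℝ^d`, defined by `(y_σ)_i = y_i` if `σ_i = 1` and `(y_σ)_i = -y_{d+i}` if
`σ_i = -1`. -/
noncomputable def ysig {d : ℕ} (y : (Fin d ⊕ Fin d) → ℝ) (σ : Fin d → ℝ) : Fin d → ℝ :=
  fun i => if σ i = 1 then y (Sum.inl i) else -(y (Sum.inr i))

/-- The candidate component `C_{σ|−σ}`. -/
noncomputable def Csig {d : ℕ} (A : Matrix (Fin d) (Fin d) ℝ) (y : (Fin d ⊕ Fin d) → ℝ)
    (σ : Fin d → ℝ) : Set (Matrix (Fin d) (Fin 2) ℝ × (Fin 2 → ℝ)) :=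
  {p | 0 < p.2 0 ∧ 0 < p.2 1 ∧
       (∀ r, p.1 r 0 = A⁻¹.mulVec (ysig y σ) r / p.2 0) ∧
       (∀ r, p.1 r 1 = A⁻¹.mulVec (ysig y (-σ)) r / p.2 1)}

lemma l2norm_smul' {M : Type*} [Fintype M] (c : ℝ) (v : M → ℝ) :
    l2norm (fun i => c * v i) = |c| * l2norm v := by
  unfold l2norm
  rw [← Real.sqrt_sq_eq_abs, ← Real.sqrt_mul (sq_nonneg c), Finset.mul_sum]
  simp only [mul_pow]

lemma mulVec_of_Cpq {d : ℕ} (p : Fin d → ℝ) (W : Matrix (Fin d) (Fin 2) ℝ) (a : Fin 2 → ℝ)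
    (h : (W, a) ∈ Cpq p (-p)) (v : Fin 2 → ℝ) :
    l2norm (W.mulVec v) = |v 0 / a 0 - v 1 / a 1| * l2norm p := by
  obtain ⟨_, _, h0, h1⟩ := h
  rw [← l2norm_smul']
  congr 1
  funext r
  simp only [Matrix.mulVec, dotProduct, Fin.sum_univ_two]
  simp only at h0 h1
  rw [h0, h1, Pi.neg_apply]
  ring

lemma l2_two {v : Fin 2 → ℝ} (h : l2norm v ≤ 1) : v 0 ^ 2 + v 1 ^ 2 ≤ 1 := by
  unfold l2norm at h
  rw [Real.sqrt_le_one, Fin.sum_univ_two] at h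
  exact h

lemma bdd_op {d : ℕ} (p : Fin d → ℝ) (W : Matrix (Fin d) (Fin 2) ℝ) (a : Fin 2 → ℝ)
    (h : (W, a) ∈ Cpq p (-p)) :
    BddAbove (Set.range fun v : {v : Fin 2 → ℝ // l2norm v ≤ 1} => l2norm (W.mulVec v.1)) := by
  refine ⟨(1 / a 0 + 1 / a 1) * l2norm p, ?_⟩
  rintro _ ⟨v, rfl⟩
  simp only
  rw [mulVec_of_Cpq p W a h]
  have h2 := l2_two v.2
  have ha : 0 < a 0 := h.1
  have hb : 0 < a 1 := h.2.1
  refine mul_le_mul_of_nonneg_right ?_ (Real.sqrt_nonneg _)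
  have e0 : |v.1 0| ≤ 1 := abs_le_one_iff_mul_self_le_one.2 (by nlinarith [sq_nonneg (v.1 1)])
  have e1 : |v.1 1| ≤ 1 := abs_le_one_iff_mul_self_le_one.2 (by nlinarith [sq_nonneg (v.1 0)])
  refine (abs_sub _ _).trans ?_
  rw [abs_div, abs_div, abs_of_pos ha, abs_of_pos hb]
  gcongr

lemma Csig_eq {d : ℕ} (A : Matrix (Fin d) (Fin d) ℝ)
    (σ : Fin d → ℝ) (hσ : ∀ i, σ i = 1 ∨ σ i = -1) :
    Csig A (fun _ => (1 : ℝ)) σ = Cpq (A⁻¹.mulVec σ) (-(A⁻¹.mulVec σ)) := by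
  have h1 : ysig (fun _ => (1 : ℝ)) σ = σ := by
    funext i
    rcases hσ i with h | h <;> simp [ysig, h]
    norm_num
  have h2 : ysig (fun _ => (1 : ℝ)) (-σ) = -σ := by
    funext i
    rcases hσ i with h | h <;> simp [ysig, h]
    norm_num
  unfold Csig Cpq
  rw [h1, h2, Matrix.mulVec_neg]

lemma mem_const {d : ℕ} (p : Fin d → ℝ) {t : ℝ} (ht : 0 < t) :
    ((fun r j => if j = 0 then p r / t else -p r / t : Matrix (Fin d) (Fin 2) ℝ),
      (fun _ => t : Fin 2 → ℝ)) ∈ Cpq p (-p) := by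
  refine ⟨ht, ht, ?_, ?_⟩ <;> intro r <;> simp

lemma inf_aux (S : Set ℝ) (n : ℝ) (hl : ∀ r ∈ S, Real.sqrt n ≤ r)
    (hu : ∀ s, 0 < s → n ≤ s ^ 2 → ∃ r ∈ S, r ≤ s) : sInf S = Real.sqrt n := by
  apply le_antisymm
  · refine le_of_forall_gt_imp_ge_of_dense fun s hs => ?_
    obtain ⟨r, hr, hrs⟩ := hu s ((Real.sqrt_nonneg _).trans_lt hs)
      ((Real.sqrt_le_left ((Real.sqrt_nonneg _).trans hs.le)).1 hs.le)
    exact (csInf_le ⟨_, hl⟩ hr).trans hrs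
  · obtain ⟨r, hr, _⟩ := hu (|n| + 1) (by positivity)
      (by nlinarith [abs_nonneg n, le_abs_self n])
    exact le_csInf ⟨r, hr⟩ hl

lemma inf_max {d : ℕ} (p : Fin d → ℝ) :
    sInf {r : ℝ | ∃ Wa ∈ Cpq p (-p), r = max (maxNorm Wa.1) (linfNorm Wa.2)} =
      Real.sqrt (linfNorm p) := by
  apply inf_aux
  · rintro r ⟨⟨W, a⟩, h, hr⟩
    have ha : 0 < a 0 := h.1
    have h0 : ∀ r, W r 0 = p r / a 0 := h.2.2.1
    have hra : a 0 ≤ r := by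
      rw [hr]
      refine le_trans ?_ (le_max_right _ _)
      exact (le_abs_self _).trans (le_ciSup (f := fun i => |a i|) (Set.finite_range _).bddAbove 0)
    have hr0 : 0 < r := ha.trans_le hra
    refine Real.sqrt_le_iff.2 ⟨hr0.le, ?_⟩
    refine Real.iSup_le (fun i => ?_) (sq_nonneg _)
    have hw : |W i 0| ≤ r := by
      rw [hr]
      refine le_trans ?_ (le_max_left _ _)
      exact (le_ciSup (f := fun j => |W i j|) (Set.finite_range _).bddAbove 0).trans
        (le_ciSup (f := fun i => ⨆ j, |W i j|) (Set.finite_range _).bddAbove i)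
    rw [h0, abs_div, abs_of_pos ha, div_le_iff₀ ha] at hw
    nlinarith
  · intro s hs hn
    refine ⟨_, ⟨_, mem_const p hs, rfl⟩, ?_⟩
    refine max_le ?_ ?_
    · refine Real.iSup_le (fun i => Real.iSup_le (fun j => ?_) hs.le) hs.le
      have hp : |p i| ≤ s ^ 2 :=
        (le_ciSup (f := fun i => |p i|) (Set.finite_range _).bddAbove i).trans hn
      have : |p i| / s ≤ s := by
        rw [div_le_iff₀ hs]
        nlinarith
      simp only
      split_ifs
      · rwa [abs_div, abs_of_pos hs]
      · rwa [abs_div, abs_neg, abs_of_pos hs]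
    · refine Real.iSup_le (fun i => ?_) hs.le
      simp only
      rw [abs_of_pos hs]

lemma inf_op {d : ℕ} (p : Fin d → ℝ) :
    sInf {r : ℝ | ∃ Wa ∈ Cpq p (-p), r = max (opNorm Wa.1) (l2norm Wa.2)} =
      Real.sqrt (2 * l2norm p) := by
  have hp : 0 ≤ l2norm p := Real.sqrt_nonneg _
  apply inf_aux
  · rintro r ⟨⟨W, a⟩, h, hr⟩
    have ha : 0 < a 0 := h.1
    have hb : 0 < a 1 := h.2.1
    have hL2 : l2norm a ^ 2 = a 0 ^ 2 + a 1 ^ 2 := by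
      unfold l2norm
      rw [Real.sq_sqrt (by positivity), Fin.sum_univ_two]
    have hL : 0 < l2norm a := by
      refine Real.sqrt_pos.2 ?_
      rw [Fin.sum_univ_two]
      positivity
    have hrL : l2norm a ≤ r := by
      rw [hr]
      exact le_max_right _ _
    have hr0 : 0 < r := hL.trans_le hrL
    refine Real.sqrt_le_iff.2 ⟨hr0.le, ?_⟩
    let v : Fin 2 → ℝ := fun j => if j = 0 then a 0 / l2norm a else -a 1 / l2norm a
    have hv : l2norm v ≤ 1 := by
      unfold l2norm
      rw [Real.sqrt_le_one, Fin.sum_univ_two]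
      simp only [v, if_true, one_ne_zero, if_false]
      rw [div_pow, div_pow, neg_sq, ← add_div, ← hL2, div_self (by positivity)]
    have hw : l2norm (W.mulVec v) ≤ r := by
      rw [hr]
      exact (le_ciSup (bdd_op p W a h) ⟨v, hv⟩).trans (le_max_left _ _)
    rw [mulVec_of_Cpq p W a h] at hw
    have hv2 : v 0 / a 0 - v 1 / a 1 = 2 / l2norm a := by
      simp only [v, if_true, one_ne_zero, if_false]
      field_simp
      norm_num
    rw [hv2, abs_of_pos (by positivity), div_mul_eq_mul_div, div_le_iff₀ hL] at hw
    nlinarith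
  · intro s hs hn
    have h2 : 0 < Real.sqrt 2 := by positivity
    have h22 : Real.sqrt 2 ^ 2 = 2 := Real.sq_sqrt (by norm_num)
    have ht : 0 < s / Real.sqrt 2 := by positivity
    have hm := mem_const p ht
    refine ⟨_, ⟨_, hm, rfl⟩, ?_⟩
    refine max_le ?_ ?_
    · refine Real.iSup_le (fun v => ?_) hs.le
      rw [mulVec_of_Cpq p _ _ hm]
      have hv := l2_two v.2
      have h3 : |v.1 0 - v.1 1| ≤ Real.sqrt 2 := by
        apply Real.abs_le_sqrt
        nlinarith [sq_nonneg (v.1 0 + v.1 1)]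
      rw [← sub_div, abs_div, abs_of_pos ht]
      have h4 : |v.1 0 - v.1 1| / (s / Real.sqrt 2) ≤ 2 / s := by
        rw [div_le_div_iff₀ ht hs]
        have : Real.sqrt 2 ^ 2 * (s / Real.sqrt 2) = Real.sqrt 2 * s := by field_simp
        rw [h22] at this
        rw [this]
        gcongr
      calc _ ≤ 2 / s * l2norm p := by gcongr
        _ ≤ s := by
          rw [div_mul_eq_mul_div, div_le_iff₀ hs]
          nlinarith
    · refine Real.sqrt_le_iff.2 ⟨hs.le, ?_⟩
      simp only [Fin.sum_univ_two]
      rw [div_pow, h22]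
      linarith

/-- for `y = 1_{2d}`, `C_{σ|−σ} = C(A⁻¹σ, −A⁻¹σ)`, the infimum of
`max{‖W‖_max, ‖α‖_∞}` over it is `‖A⁻¹σ‖_∞^{1/2}`, and the infimum of
`max{‖W‖_op, ‖α‖₂}` over it is `(2‖A⁻¹σ‖₂)^{1/2}`. -/
theorem Csig_norm_minima {d : ℕ} (A : Matrix (Fin d) (Fin d) ℝ) (hA : IsUnit A.det)
    (σ : Fin d → ℝ) (hσ : ∀ i, σ i = 1 ∨ σ i = -1) :
    Csig A (fun _ => (1 : ℝ)) σ = Cpq (A⁻¹.mulVec σ) (-(A⁻¹.mulVec σ)) ∧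
    sInf {r : ℝ | ∃ Wa ∈ Csig A (fun _ => (1 : ℝ)) σ,
        r = max (maxNorm Wa.1) (linfNorm Wa.2)} =
      Real.sqrt (linfNorm (A⁻¹.mulVec σ)) ∧
    sInf {r : ℝ | ∃ Wa ∈ Csig A (fun _ => (1 : ℝ)) σ,
        r = max (opNorm Wa.1) (l2norm Wa.2)} =
      Real.sqrt (2 * l2norm (A⁻¹.mulVec σ)) := by
  have h := Csig_eq A σ hσ
  refine ⟨h, ?_, ?_⟩
  · rw [h]
    exact inf_max _
  · rw [h]
    exact inf_op _
end

section
/- Let d ≥ 2 be an integer and let L be a real number with 1 < L < √d. Define B ∈ ℝ^{d×d} by B_{11} = (1 + L)/2; B_{1j} = (1 − L)/(2(d − 1)) for 2 ≤ j ≤ d; B_{i1} = 1/2 for 2 ≤ i ≤ d; and, for 2 ≤ i, j ≤ d, B_{ij} = 1 − 1/(2(d − 1)) if i = j and B_{ij} = −1/(2(d − 1)) if i ≠ j. Let h₁ = (1, 1, …, 1)ᵀ and h₂ = (1, −1, …, −1)ᵀ. Then for every σ ∈ {±1}^d: ‖Bσ‖_∞ ≥ 1 with equality if and only if σ = ±h₁,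 and ‖Bσ‖₂ ≥ L with equality if and only if σ = ±h₂. Moreover, for σ with σ₁ = 1, writing k for the number of indices i ∈ {2, …, d} with σ_i = −1 and r = k/(d − 1), one has ‖Bσ‖₂² = (1 + (L − 1)r)² + (d − 1)(1 + 2r − 3r²). -/
open scoped BigOperators

/-- The matrix `B` of the finite-width construction. -/
noncomputable def Bmat (d : ℕ) (L : ℝ) : Matrix (Fin d) (Fin d) ℝ :=
  fun i j =>
    if (i : ℕ) = 0 then
      (if (j : ℕ) = 0 then (1 + L) / 2 else (1 - L) / (2 * ((d : ℝ) - 1)))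
    else
      (if (j : ℕ) = 0 then 1 / 2
       else if i = j then 1 - 1 / (2 * ((d : ℝ) - 1))
       else -(1 / (2 * ((d : ℝ) - 1))))


lemma row0 (n : ℕ) (L : ℝ) (σ : Fin (n+1) → ℝ) :
    (Bmat (n+1) L).mulVec σ 0 = (1+L)/2 * σ 0 + (1 - L)/(2*(n:ℝ)) * ∑ j : Fin n, σ j.succ := by
  simp [Matrix.mulVec, dotProduct, Bmat, Fin.sum_univ_succ, Finset.mul_sum]

lemma rowS (n : ℕ) (L : ℝ) (σ : Fin (n+1) → ℝ) (i : Fin n) :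
    (Bmat (n+1) L).mulVec σ i.succ
      = σ 0 / 2 + σ i.succ - 1/(2*(n:ℝ)) * ∑ j : Fin n, σ j.succ := by
  have h : ∀ j : Fin n, Bmat (n+1) L i.succ j.succ * σ j.succ
      = (if i = j then σ j.succ else 0) - 1/(2*(n:ℝ)) * σ j.succ := by
    intro j
    by_cases hij : i = j
    · simp [Bmat, hij]; ring
    · simp [Bmat, hij]
  have h0 : Bmat (n+1) L i.succ 0 = 1/2 := by simp [Bmat]
  rw [Matrix.mulVec, dotProduct, Fin.sum_univ_succ, h0]
  simp only [h, Finset.sum_sub_distrib, ← Finset.mul_sum, Finset.sum_ite_eq, Finset.mem_univ,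
    if_true]
  ring

lemma ncard_eq (n : ℕ) (hn : 1 ≤ n) (σ : Fin (n+1) → ℝ) (hσ : ∀ i, σ i = 1 ∨ σ i = -1) :
    ((Set.ncard {i : Fin (n+1) | (i : ℕ) ≠ 0 ∧ σ i = -1} : ℕ) : ℝ) / n
      = (1 - (∑ j : Fin n, σ j.succ) / n) / 2 := by
  classical
  have hn' : (n:ℝ) ≠ 0 := by positivity
  have h1 : ((Set.ncard {i : Fin (n+1) | (i : ℕ) ≠ 0 ∧ σ i = -1} : ℕ) : ℝ)
      = ∑ j : Fin n, (1 - σ j.succ) / 2 := by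
    have : {i : Fin (n+1) | (i : ℕ) ≠ 0 ∧ σ i = -1}
        = ((Finset.univ.filter fun i : Fin (n+1) => (i : ℕ) ≠ 0 ∧ σ i = -1 : Finset _) : Set _) := by
      ext; simp
    rw [this, Set.ncard_coe_finset, Finset.card_filter]
    push_cast
    rw [Fin.sum_univ_succ]
    simp only [Fin.val_zero, ne_eq, not_true_eq_false, false_and, if_false, zero_add]
    refine Finset.sum_congr rfl fun j _ => ?_
    rcases hσ j.succ with h | h <;> norm_num [h]
  rw [h1, ← Finset.sum_div, Finset.sum_sub_distrib]
  simp
  field_simp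

lemma l2sq_s18 (n : ℕ) (hn : 1 ≤ n) (L : ℝ) (σ : Fin (n+1) → ℝ) (hσ : ∀ i, σ i = 1 ∨ σ i = -1)
    (h0 : σ 0 = 1) (r : ℝ) (hr : r = (1 - (∑ j : Fin n, σ j.succ) / n) / 2) :
    l2norm ((Bmat (n+1) L).mulVec σ) ^ 2
      = (1 + (L-1)*r)^2 + n * (1 + 2*r - 3*r^2) := by
  have hn' : (n:ℝ) ≠ 0 := by positivity
  have hS : ∑ j : Fin n, σ j.succ = n * (1 - 2*r) := by rw [hr]; field_simp; ring
  rw [l2norm, Real.sq_sqrt (Finset.sum_nonneg fun i _ => sq_nonneg _), Fin.sum_univ_succ, row0]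
  have h : ∀ i : Fin n, ((Bmat (n+1) L).mulVec σ i.succ)^2 = 1 + r^2 + 2*r*σ i.succ := by
    intro i
    rw [rowS, h0, hS]
    have : 1 / 2 + σ i.succ - 1 / (2 * (n:ℝ)) * (n * (1 - 2 * r)) = σ i.succ + r := by
      field_simp; ring
    rw [this]
    rcases hσ i.succ with h | h <;> rw [h] <;> ring
  simp only [h, Finset.sum_add_distrib, ← Finset.mul_sum, hS, h0]
  simp
  field_simp
  ring

lemma le_of_sq_le_sq_aux (a b : ℝ) (hb : 0 ≤ b) (h : a^2 ≤ b^2) : a ≤ b :=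
  le_of_abs_le ((sq_le_sq.1 h).trans (abs_of_nonneg hb).le)

lemma core (n : ℕ) (hn : 1 ≤ n) (L : ℝ) (hL1 : 1 < L) (hL2 : L < Real.sqrt ((n:ℝ)+1))
    (σ : Fin (n+1) → ℝ) (hσ : ∀ i, σ i = 1 ∨ σ i = -1) (h0 : σ 0 = 1) :
    (1 ≤ linfNorm ((Bmat (n+1) L).mulVec σ) ∧
        (linfNorm ((Bmat (n+1) L).mulVec σ) = 1 ↔ ∀ i : Fin n, σ i.succ = 1)) ∧
      (L ≤ l2norm ((Bmat (n+1) L).mulVec σ) ∧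
        (l2norm ((Bmat (n+1) L).mulVec σ) = L ↔ ∀ i : Fin n, σ i.succ = -1)) := by
  have hn' : (n:ℝ) ≠ 0 := by positivity
  have hn1 : (1:ℝ) ≤ n := by exact_mod_cast hn
  obtain ⟨r, hr⟩ : ∃ r, r = (1 - (∑ j : Fin n, σ j.succ) / n) / 2 := ⟨_, rfl⟩
  have hS : ∑ j : Fin n, σ j.succ = n * (1 - 2*r) := by rw [hr]; field_simp; ring
  have hub : ∀ j : Fin n, 0 ≤ 1 - σ j.succ := by
    intro j; rcases hσ j.succ with h | h <;> norm_num [h]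
  have hlb : ∀ j : Fin n, 0 ≤ 1 + σ j.succ := by
    intro j; rcases hσ j.succ with h | h <;> norm_num [h]
  have e1 : ∑ j : Fin n, (1 - σ j.succ) = 2 * n * r := by
    rw [Finset.sum_sub_distrib, hS]; simp; ring
  have e2 : ∑ j : Fin n, (1 + σ j.succ) = 2 * n * (1 - r) := by
    rw [Finset.sum_add_distrib, hS]; simp; ring
  have hr0 : 0 ≤ r := by
    have := Finset.sum_nonneg (s := Finset.univ) fun j _ => hub j
    rw [e1] at this
    by_contra hc
    nlinarith
  have hr1 : r ≤ 1 := by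
    have := Finset.sum_nonneg (s := Finset.univ) fun j _ => hlb j
    rw [e2] at this
    by_contra hc
    nlinarith
  have r0iff : r = 0 ↔ ∀ i : Fin n, σ i.succ = 1 := by
    have := Finset.sum_eq_zero_iff_of_nonneg (s := Finset.univ) fun j _ => hub j
    rw [e1] at this
    constructor
    · intro h i
      have := this.1 (by rw [h]; ring) i (Finset.mem_univ _)
      linarith
    · intro h
      have := this.2 (fun i _ => by rw [h i]; ring)
      simpa [hn'] using this
  have r1iff : r = 1 ↔ ∀ i : Fin n, σ i.succ = -1 := by
    have := Finset.sum_eq_zero_iff_of_nonneg (s := Finset.univ) fun j _ => hlb j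
    rw [e2] at this
    constructor
    · intro h i
      have := this.1 (by rw [h]; ring) i (Finset.mem_univ _)
      linarith
    · intro h
      have := this.2 (fun i _ => by rw [h i]; ring)
      have : 1 - r = 0 := by simpa [hn'] using this
      linarith
  have R0 : (Bmat (n+1) L).mulVec σ 0 = 1 + (L-1)*r := by
    rw [row0, hS, h0]; field_simp; ring
  have RS : ∀ i : Fin n, (Bmat (n+1) L).mulVec σ i.succ = σ i.succ + r := by
    intro i; rw [rowS, hS, h0]; field_simp; ring
  have hge : 1 + (L-1)*r ≤ linfNorm ((Bmat (n+1) L).mulVec σ) := by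
    rw [← R0]
    exact (le_abs_self _).trans
      (le_ciSup (f := fun i => |(Bmat (n+1) L).mulVec σ i|) (Set.finite_range _).bddAbove 0)
  have hprod : 0 ≤ (L-1)*r := mul_nonneg (by linarith) hr0
  have hl2 := l2sq_s18 n hn L σ hσ h0 r hr
  have hpos : 0 ≤ l2norm ((Bmat (n+1) L).mulVec σ) := Real.sqrt_nonneg _
  have hLsq : L^2 < n + 1 := by
    have := (Real.lt_sqrt (by linarith)).1 hL2
    exact this
  have hid : (1 + (L-1)*r)^2 + n * (1 + 2*r - 3*r^2) - L^2
      = (1 - r) * ((n + 1 - L^2) + r * (3*n - (L-1)^2)) := by ring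
  have hc : 0 < 3*n - (L-1)^2 := by nlinarith
  have hfac : 0 < (n + 1 - L^2) + r * (3*n - (L-1)^2) := by
    have := mul_nonneg hr0 hc.le
    linarith
  refine ⟨⟨by linarith, ?_⟩, ?_, ?_⟩
  · rw [← r0iff]
    constructor
    · intro h
      have h2 : (L-1)*r = 0 := by linarith
      rcases mul_eq_zero.1 h2 with h | h
      · linarith
      · exact h
    · intro h
      have hall := r0iff.1 h
      have : ∀ i, |(Bmat (n+1) L).mulVec σ i| = 1 := by
        intro i
        refine Fin.cases ?_ (fun j => ?_) i
        · rw [R0, h]; simp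
        · rw [RS, h, hall]; simp
      rw [linfNorm]
      simp [this]
  · apply le_of_sq_le_sq_aux _ _ hpos
    rw [hl2]
    have := mul_nonneg (sub_nonneg.2 hr1) hfac.le
    linarith
  · rw [← r1iff]
    constructor
    · intro h
      rw [h] at hl2
      have : (1 - r) * ((n + 1 - L^2) + r * (3*n - (L-1)^2)) = 0 := by linarith
      rcases mul_eq_zero.1 this with h | h
      · linarith
      · linarith
    · intro h
      have h3 : l2norm ((Bmat (n+1) L).mulVec σ) ^ 2 = L^2 := by rw [hl2, h]; ring
      exact (sq_eq_sq₀ hpos (by linarith)).1 h3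

/-- minimizers of `‖Bσ‖_∞` and `‖Bσ‖₂` over sign vectors, and the
closed-form expression of `‖Bσ‖₂²`. -/
theorem Bmat_sign_minimizers (d : ℕ) (hd : 2 ≤ d) (L : ℝ)
    (hL1 : 1 < L) (hL2 : L < Real.sqrt d) :
    let h₁ : Fin d → ℝ := fun _ => 1
    let h₂ : Fin d → ℝ := fun i => if (i : ℕ) = 0 then 1 else -1
    (∀ σ : Fin d → ℝ, (∀ i, σ i = 1 ∨ σ i = -1) →
      (1 ≤ linfNorm ((Bmat d L).mulVec σ) ∧
        (linfNorm ((Bmat d L).mulVec σ) = 1 ↔ σ = h₁ ∨ σ = -h₁)) ∧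
      (L ≤ l2norm ((Bmat d L).mulVec σ) ∧
        (l2norm ((Bmat d L).mulVec σ) = L ↔ σ = h₂ ∨ σ = -h₂))) ∧
    (∀ σ : Fin d → ℝ, (∀ i, σ i = 1 ∨ σ i = -1) →
      (∀ i : Fin d, (i : ℕ) = 0 → σ i = 1) →
      l2norm ((Bmat d L).mulVec σ) ^ 2 =
        (1 + (L - 1) *
            ((Set.ncard {i : Fin d | (i : ℕ) ≠ 0 ∧ σ i = -1} : ℝ) / ((d : ℝ) - 1))) ^ 2 +
          ((d : ℝ) - 1) *
            (1 + 2 * ((Set.ncard {i : Fin d | (i : ℕ) ≠ 0 ∧ σ i = -1} : ℝ) / ((d : ℝ) - 1)) -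
              3 * ((Set.ncard {i : Fin d | (i : ℕ) ≠ 0 ∧ σ i = -1} : ℝ) / ((d : ℝ) - 1)) ^ 2)) := by
  obtain ⟨n, rfl⟩ : ∃ n, d = n + 1 := ⟨d - 1, by omega⟩
  have hn : 1 ≤ n := by omega
  have hc : ((n + 1 : ℕ) : ℝ) - 1 = n := by push_cast; ring
  have hL2' : L < Real.sqrt ((n:ℝ)+1) := by simpa using hL2
  intro h₁ h₂
  refine ⟨?_, ?_⟩
  · intro σ hσ
    have ne1 : (1:ℝ) ≠ -1 := by norm_num
    rcases hσ 0 with h0 | h0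
    · obtain ⟨⟨a, b⟩, c, e⟩ := core n hn L hL1 hL2' σ hσ h0
      refine ⟨⟨a, b.trans ?_⟩, c, e.trans ?_⟩
      · constructor
        · intro h
          left; funext i
          exact Fin.cases h0 (fun j => h j) i
        · rintro (h | h) i
          · rw [h]
          · have := congrFun h 0
            rw [h0] at this
            exact absurd this ne1
      · constructor
        · intro h
          left; funext i
          refine Fin.cases ?_ (fun j => ?_) i
          · simp [h₂, h0]
          · simp [h₂, h j]
        · rintro (h | h) i
          · rw [h]; simp [h₂]
          · have := congrFun h 0
            simp [h₂, h0] at this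
            exact absurd this ne1
    · have hσ' : ∀ i, (-σ) i = 1 ∨ (-σ) i = -1 := by
        intro i; rcases hσ i with h | h <;> simp [h]
      have h := core n hn L hL1 hL2' (-σ) hσ' (by simp [h0])
      have k1 : linfNorm ((Bmat (n+1) L).mulVec (-σ)) = linfNorm ((Bmat (n+1) L).mulVec σ) := by
        simp [linfNorm, Matrix.mulVec_neg]
      have k2 : l2norm ((Bmat (n+1) L).mulVec (-σ)) = l2norm ((Bmat (n+1) L).mulVec σ) := by
        simp [l2norm, Matrix.mulVec_neg]
      rw [k1, k2] at h
      obtain ⟨⟨a, b⟩, c, e⟩ := h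
      refine ⟨⟨a, b.trans ?_⟩, c, e.trans ?_⟩
      · constructor
        · intro h
          right; funext i
          refine Fin.cases h0 (fun j => ?_) i
          have := h j
          simp only [Pi.neg_apply] at this
          simp only [Pi.neg_apply, h₁]
          linarith
        · rintro (h | h) i
          · have := congrFun h 0
            rw [h0] at this
            exact absurd this.symm ne1
          · rw [h]; simp [h₁]
      · constructor
        · intro h
          right; funext i
          refine Fin.cases ?_ (fun j => ?_) i
          · simp [h₂, h0]
          · have := h j
            simp only [Pi.neg_apply] at this
            simp [h₂]
            linarith
        · rintro (h | h) i
          · have := congrFun h 0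
            simp [h₂, h0] at this
            exact absurd this.symm ne1
          · rw [h]; simp [h₂]
  · intro σ hσ h0
    rw [hc]
    exact l2sq_s18 n hn L σ hσ (h0 0 rfl) _ (ncard_eq n hn σ hσ)
end

section
/- Let A ∈ ℝ^{d×d} be invertible, X = [A; −A] ∈ ℝ^{2d×d}, and y = 𝟏_{2d} the all-ones vector, and define the loss L(W, α) = (1/2)‖(XW)_+ α − y‖₂² for W ∈ ℝ^{d×2}, α ∈ ℝ². Let γ : [0,1] → ℝ^{d×2} × ℝ², γ(τ) = (W(τ), α(τ)), be a continuous path whose endpoints satisfy L(γ(0)) = 0 and L(γ(1)) = 0, and suppose there exists a coordinate i ∈ {1,…,d} with (A W_{·1}(0))_i · (A W_{·1}(1))_i < 0 (i.e., the sign vector of A W_{·1} differs between the two endpoints). Then there exists τ* ∈ [0,1] with L(γ(τ*)) ≥ 1/2. -/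
open scoped BigOperators

/-- Squared loss `L(W, α) = ½‖(XW)₊α − y‖₂²` for the width-2 construction with
`X = [A; −A]` and `y = 1_{2d}`. -/
noncomputable def sqLoss {d : ℕ} (A : Matrix (Fin d) (Fin d) ℝ)
    (p : Matrix (Fin d) (Fin 2) ℝ × (Fin 2 → ℝ)) : ℝ :=
  (1 / 2) * ∑ i : Fin d ⊕ Fin d,
    (nnOut (Matrix.fromRows A (-A)) p.1 p.2 i - 1) ^ 2

/-- a continuous path between two zero-loss points whose first-neuron sign
pattern differs in some coordinate must incur loss at least `1/2` somewhere. -/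
theorem loss_barrier {d : ℕ} (A : Matrix (Fin d) (Fin d) ℝ) (hA : IsUnit A.det)
    (γ : ℝ → Matrix (Fin d) (Fin 2) ℝ × (Fin 2 → ℝ))
    (hcont : ContinuousOn γ (Set.Icc (0 : ℝ) 1))
    (h0 : sqLoss A (γ 0) = 0) (h1 : sqLoss A (γ 1) = 0)
    (hsign : ∃ i : Fin d,
      A.mulVec (mcol (γ 0).1 0) i * A.mulVec (mcol (γ 1).1 0) i < 0) :
    ∃ τ ∈ Set.Icc (0 : ℝ) 1, 1 / 2 ≤ sqLoss A (γ τ) := by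
  obtain ⟨i, hi⟩ := hsign
  have hc : ContinuousOn (fun τ => A.mulVec (mcol (γ τ).1 0) i) (Set.Icc (0 : ℝ) 1) := by
    have hF : Continuous (fun p : Matrix (Fin d) (Fin 2) ℝ × (Fin 2 → ℝ) =>
        A.mulVec (mcol p.1 0) i) := by
      simp only [Matrix.mulVec, dotProduct, mcol]
      refine continuous_finsetSum _ fun j _ => continuous_const.mul ?_
      exact continuous_fst.matrix_elem j 0
    exact hF.comp_continuousOn hcont
  have hz : ∃ τ ∈ Set.Icc (0 : ℝ) 1, A.mulVec (mcol (γ τ).1 0) i = 0 := by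
    rcases mul_neg_iff.1 hi with ⟨ha, hb⟩ | ⟨ha, hb⟩
    · exact intermediate_value_Icc' zero_le_one hc ⟨hb.le, ha.le⟩
    · exact intermediate_value_Icc zero_le_one hc ⟨ha.le, hb.le⟩
  obtain ⟨τ, hτ, hz⟩ := hz
  refine ⟨τ, hτ, ?_⟩
  have hz' : (A * (γ τ).1) i 0 = 0 := hz
  have key : ∃ k : Fin d ⊕ Fin d, nnOut (Matrix.fromRows A (-A)) (γ τ).1 (γ τ).2 k = 0 := by
    rcases le_total ((A * (γ τ).1) i 1) 0 with h | h
    · refine ⟨Sum.inl i, ?_⟩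
      simp [nnOut, Matrix.mulVec, dotProduct, Fin.sum_univ_two, Matrix.fromRows_mul, relu, hz', h]
    · refine ⟨Sum.inr i, ?_⟩
      simp [nnOut, Matrix.mulVec, dotProduct, Fin.sum_univ_two, Matrix.fromRows_mul, relu, hz', h]
  obtain ⟨k, hk⟩ := key
  have := Finset.single_le_sum (f := fun i : Fin d ⊕ Fin d =>
    (nnOut (Matrix.fromRows A (-A)) (γ τ).1 (γ τ).2 i - 1) ^ 2)
    (fun _ _ => sq_nonneg _) (Finset.mem_univ k)
  simp only [hk] at this
  unfold sqLoss
  linarith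
end
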